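/- arXiv:2401.05027 — 2 statements merged into one kernel-verified Lean document; each statement's English description precedes it below -/
import Mathlib

section
/- Let x ∈ X, let (T_k)_{k=1}^∞ be a sequence of positive reals with T_k → ∞, and set N_k = ⌊T_k⌋ + 1. Let μ and μ' be finite Borel measures on X. Assume that for every continuous function f : X → ℝ vanishing at infinity: (1/T_k²)·∫_{[0,T_k]²} f(a_{s,t}·x) ds dt → ∫_X f dμ and (1/N_k²)·Σ_{m,n=0}^{N_k−1} f(a_{m,n}·x) → ∫_X f dμ' as k → ∞. Then for every continuous function f : X → ℝ vanishing at infinity, ∫_{[0,1]²} ( ∫_X f(a_{s,t}·y) dμ'(y) ) ds dt = ∫_X f dμ; in particular μ'(X) = μ(X). -/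
open Filter MeasureTheory Matrix

/-- `a_{s,t} = diag(e^{-s-t}, e^s, e^t) ∈ SL(3,ℝ)`. -/
noncomputable def aSL (s t : ℝ) : Matrix.SpecialLinearGroup (Fin 3) ℝ :=
  ⟨Matrix.diagonal ![Real.exp (-s - t), Real.exp s, Real.exp t], by
    rw [Matrix.det_diagonal]
    simp [Fin.prod_univ_three, ← Real.exp_add]
    ring_nf⟩

/-- `SL(3,ℝ)` carries the topology induced from the `3 × 3` matrices. -/
instance : TopologicalSpace (Matrix.SpecialLinearGroup (Fin 3) ℝ) :=
  TopologicalSpace.induced (fun g => (g : Matrix (Fin 3) (Fin 3) ℝ)) inferInstance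

/-- `Γ = SL(3,ℤ)`, viewed as a subgroup of `SL(3,ℝ)`. -/
abbrev SL3Z : Subgroup (Matrix.SpecialLinearGroup (Fin 3) ℝ) :=
  (Matrix.SpecialLinearGroup.map (n := Fin 3) (Int.castRingHom ℝ)).range

/-- `X = SL(3,ℝ)/SL(3,ℤ)` with the quotient topology. -/
abbrev X := Matrix.SpecialLinearGroup (Fin 3) ℝ ⧸ SL3Z

/-- `X` carries the Borel σ-algebra of the quotient topology. -/
noncomputable instance : MeasurableSpace X := borel X
instance : BorelSpace X := ⟨rfl⟩

namespace QuotientGroup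

/-- The quotient of a topological group by an arbitrary subgroup is a regular space. -/
theorem regularSpace {G : Type*} [Group G] [TopologicalSpace G] [IsTopologicalGroup G]
    (H : Subgroup G) : RegularSpace (G ⧸ H) := by
  refine .of_exists_mem_nhds_isClosed_subset fun x s hs => ?_
  have hc : Continuous fun p : G × G => (p.1⁻¹ * p.2) • x := by fun_prop
  have hs' : (fun p : G × G => (p.1⁻¹ * p.2) • x) ⁻¹' s ∈ nhds ((1 : G), (1 : G)) :=
    hc.continuousAt.preimage_mem_nhds (by simpa using hs)
  rw [nhds_prod_eq, Filter.mem_prod_same_iff] at hs'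
  obtain ⟨V, hV, hVs⟩ := hs'
  have hopen : ∀ y : G ⧸ H, (fun g : G => g • y) '' V ∈ nhds y := fun y => by
    induction y using QuotientGroup.induction_on with
    | H y =>
      have hy : IsOpenMap fun g : G => g • (y : G ⧸ H) :=
        isOpenMap_coe.comp (isOpenMap_mul_right y)
      simpa using hy.image_mem_nhds hV
  refine ⟨closure ((fun g : G => g • x) '' V), mem_of_superset (hopen x) subset_closure,
    isClosed_closure, fun y hy => ?_⟩
  obtain ⟨_, ⟨v, hv, rfl⟩, w, hw, hwv⟩ := mem_closure_iff_nhds.1 hy _ (hopen y)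
  have hyx : y = (v⁻¹ * w) • x := by
    rw [mul_smul, eq_inv_smul_iff]
    exact hwv.symm
  rw [hyx]
  exact hVs (Set.mk_mem_prod hv hw)

end QuotientGroup

section VanishingAtInfinity

variable {Y : Type*} [TopologicalSpace Y]

theorem exists_forall_norm_le_of_tendsto_cocompact {f : Y → ℝ} (hf : Continuous f)
    (hf_zero : Tendsto f (cocompact Y) (nhds 0)) : ∃ C, ∀ y, ‖f y‖ ≤ C := by
  obtain ⟨K, hK, hKf⟩ := mem_cocompact.1 (hf_zero (Metric.ball_mem_nhds 0 one_pos))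
  obtain ⟨C, hC⟩ := hK.exists_bound_of_continuousOn hf.continuousOn
  refine ⟨max C 1, fun y => ?_⟩
  by_cases hy : y ∈ K
  · exact (hC y hy).trans (le_max_left _ _)
  · have := hKf hy
    simp only [Set.mem_preimage, mem_ball_zero_iff] at this
    exact this.le.trans (le_max_right _ _)

/-- Finite measures which agree on continuous functions vanishing at infinity have the same
total mass. -/
theorem measure_univ_eq_of_forall_integral_eq [RegularSpace Y] [LocallyCompactSpace Y]
    [SigmaCompactSpace Y] [MeasurableSpace Y] [BorelSpace Y] (μ ν : Measure Y)
    [IsFiniteMeasure μ] [IsFiniteMeasure ν]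
    (h : ∀ f : Y → ℝ, Continuous f → Tendsto f (cocompact Y) (nhds 0) →
      ∫ y, f y ∂μ = ∫ y, f y ∂ν) :
    μ Set.univ = ν Set.univ := by
  have hex : ∀ n : ℕ, ∃ f : C(Y, ℝ), Set.EqOn f 1 (compactCovering Y n) ∧
      HasCompactSupport f ∧ ∀ y, f y ∈ Set.Icc (0 : ℝ) 1 := fun n => by
    obtain ⟨f, hf1, -, hf, hf01⟩ := exists_continuous_one_zero_of_isCompact
      (isCompact_compactCovering Y n) isClosed_empty (Set.disjoint_empty _)
    exact ⟨f, hf1, hf, hf01⟩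
  choose f hf1 hfc hf01 using hex
  have hlim : ∀ ρ : Measure Y, IsFiniteMeasure ρ →
      Tendsto (fun n => ∫ y, f n y ∂ρ) atTop (nhds (∫ _, (1 : ℝ) ∂ρ)) := fun ρ _ => by
    refine tendsto_integral_of_dominated_convergence (fun _ => 1)
      (fun n => (f n).continuous.aestronglyMeasurable) (integrable_const 1)
      (fun n => ae_of_all _ fun y => ?_) (ae_of_all _ fun y => ?_)
    · rw [Real.norm_of_nonneg (hf01 n y).1]
      exact (hf01 n y).2
    · obtain ⟨m, hm⟩ := exists_mem_compactCovering y
      exact tendsto_const_nhds.congr' <| (eventually_ge_atTop m).mono fun n hn =>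
        (hf1 n (compactCovering_subset Y hn hm)).symm
  have heq := tendsto_nhds_unique (hlim μ inferInstance)
    ((hlim ν inferInstance).congr fun n =>
      (h _ (f n).continuous (hfc n).is_zero_at_infty).symm)
  simpa [Measure.real, ENNReal.toReal_eq_toReal_iff'] using heq

variable {G Z : Type*} [Group G] [TopologicalSpace G] [MulAction G Y] [ContinuousSMul G Y]
  [TopologicalSpace Z] [MeasurableSpace Z]

/-- Averaging over a compact family of translations preserves continuity. -/
theorem continuous_setIntegral_smul [OpensMeasurableSpace Z] [FirstCountableTopology Y]
    [LocallyCompactSpace Y]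
    {ρ : Measure Z} [IsLocallyFiniteMeasure ρ] {a : Z → G} (ha : Continuous a) {P : Set Z}
    (hP : IsCompact P) {f : Y → ℝ} (hf : Continuous f) :
    Continuous fun y => ∫ p in P, f (a p • y) ∂ρ := by
  refine continuous_parametric_integral_of_continuous (f := fun y p => f (a p • y)) ?_ hP
  simp only [Function.uncurry_def]
  fun_prop

/-- Averaging over a compact family of translations preserves vanishing at infinity. -/
theorem tendsto_cocompact_setIntegral_smul [ContinuousInv G] {ρ : Measure Z}
    [IsFiniteMeasureOnCompacts ρ] {a : Z → G} (ha : Continuous a) {P : Set Z} (hP : IsCompact P)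
    {f : Y → ℝ}
    (hf_zero : Tendsto f (cocompact Y) (nhds 0)) :
    Tendsto (fun y => ∫ p in P, f (a p • y) ∂ρ) (cocompact Y) (nhds 0) := by
  rw [Metric.tendsto_nhds]
  intro ε hε
  have hρ : 0 < ρ.real P + 1 := by positivity
  obtain ⟨K, hK, hKf⟩ := mem_cocompact.1
    (hf_zero (Metric.ball_mem_nhds 0 (div_pos hε hρ)))
  have hK' : IsCompact ((fun q : Z × Y => (a q.1)⁻¹ • q.2) '' P ×ˢ K) :=
    (hP.prod hK).image (by fun_prop)
  filter_upwards [hK'.compl_mem_cocompact] with y hy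
  rw [dist_zero_right]
  refine (norm_setIntegral_le_of_norm_le_const (C := ε / (ρ.real P + 1)) hP.measure_lt_top
    fun p hp => ?_).trans_lt ?_
  · have hpy : a p • y ∈ Kᶜ := fun hpK => hy ⟨(p, a p • y), ⟨hp, hpK⟩, inv_smul_smul _ _⟩
    have := hKf hpy
    simp only [Set.mem_preimage, mem_ball_zero_iff] at this
    exact this.le
  · rw [div_mul_eq_mul_div, div_lt_iff₀ hρ]
    gcongr
    exact lt_add_one _

end VanishingAtInfinity

section Square

theorem setIntegral_Icc_prod_Icc {g : ℝ × ℝ → ℝ} (hg : Continuous g) {b : ℝ} (hb : 0 ≤ b) :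
    ∫ p in Set.Icc (0 : ℝ) b ×ˢ Set.Icc (0 : ℝ) b, g p =
      ∫ s in (0 : ℝ)..b, ∫ t in (0 : ℝ)..b, g (s, t) := by
  have hint : IntegrableOn g (Set.Icc (0 : ℝ) b ×ˢ Set.Icc (0 : ℝ) b)
      ((volume : Measure ℝ).prod volume) :=
    hg.continuousOn.integrableOn_compact (isCompact_Icc.prod isCompact_Icc)
  rw [Measure.volume_eq_prod, setIntegral_prod _ hint]
  simp only [intervalIntegral.integral_of_le hb, integral_Icc_eq_integral_Ioc]

/-- The integral over `[0,n]²` is the sum of the integrals over the unit squares with integer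
vertices. -/
theorem setIntegral_Icc_natCast_prod_eq_sum {g : ℝ × ℝ → ℝ} (hg : Continuous g) (n : ℕ) :
    ∫ p in Set.Icc (0 : ℝ) n ×ˢ Set.Icc (0 : ℝ) n, g p =
      ∑ i ∈ Finset.range n, ∑ j ∈ Finset.range n,
        ∫ p in Set.Icc (0 : ℝ) 1 ×ˢ Set.Icc (0 : ℝ) 1, g (p.1 + i, p.2 + j) := by
  have hsum : ∀ u : ℝ → ℝ, Continuous u →
      ∫ s in (0 : ℝ)..n, u s = ∑ i ∈ Finset.range n, ∫ s in (0 : ℝ)..1, u (s + i) := by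
    intro u hu
    have := intervalIntegral.sum_integral_adjacent_intervals (μ := volume) (f := u)
      (a := fun k : ℕ => (k : ℝ)) (n := n) fun k _ => hu.intervalIntegrable _ _
    rw [Nat.cast_zero] at this
    rw [← this]
    refine Finset.sum_congr rfl fun i _ => ?_
    rw [intervalIntegral.integral_comp_add_right]
    simp [add_comm]
  have hcont : ∀ c d : ℝ, Continuous fun s : ℝ => ∫ t in (0 : ℝ)..1, g (s + c, t + d) := fun c d =>
    intervalIntegral.continuous_parametric_intervalIntegral_of_continuous'
      (f := fun s t => g (s + c, t + d)) (by simp only [Function.uncurry_def]; fun_prop) 0 1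
  rw [setIntegral_Icc_prod_Icc hg n.cast_nonneg]
  have hinner : ∀ s : ℝ, ∫ t in (0 : ℝ)..n, g (s, t) =
      ∑ j ∈ Finset.range n, ∫ t in (0 : ℝ)..1, g (s, t + j) := fun s =>
    hsum _ (by fun_prop)
  simp only [hinner]
  rw [intervalIntegral.integral_finsetSum fun j _ => by
    simpa using (hcont 0 j).intervalIntegrable _ _, Finset.sum_comm]
  refine Finset.sum_congr rfl fun j _ => ?_
  rw [hsum _ (by simpa using hcont 0 j)]
  refine Finset.sum_congr rfl fun i _ => ?_
  rw [setIntegral_Icc_prod_Icc (g := fun p => g (p.1 + i, p.2 + j)) (by fun_prop) zero_le_one]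

/-- Averages of a bounded function over `[0,T]²` and `[0,N]²` are close when `T ≤ N ≤ T + 1`. -/
theorem abs_average_Icc_prod_sub_le {g : ℝ × ℝ → ℝ} (hg : Continuous g) {C : ℝ}
    (hC : ∀ p, ‖g p‖ ≤ C) {T N : ℝ} (hT : 0 < T) (hTN : T ≤ N) (hNT : N ≤ T + 1) :
    |(1 / N ^ 2) * (∫ p in Set.Icc (0 : ℝ) N ×ˢ Set.Icc (0 : ℝ) N, g p) -
      (1 / T ^ 2) * ∫ p in Set.Icc (0 : ℝ) T ×ˢ Set.Icc (0 : ℝ) T, g p| ≤ 4 * C / T := by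
  have hN : 0 < N := hT.trans_le hTN
  have hC0 : 0 ≤ C := (norm_nonneg _).trans (hC 0)
  set S : ℝ → Set (ℝ × ℝ) := fun b => Set.Icc (0 : ℝ) b ×ˢ Set.Icc (0 : ℝ) b
  have hScomp : ∀ b, IsCompact (S b) := fun b => isCompact_Icc.prod isCompact_Icc
  have hSvol : ∀ b, 0 ≤ b → volume.real (S b) = b ^ 2 := fun b hb => by
    rw [Measure.volume_eq_prod, measureReal_prod_prod, Real.volume_real_Icc_of_le hb, sub_zero, sq]
  have hsub : S T ⊆ S N := Set.prod_mono (Set.Icc_subset_Icc_right hTN)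
    (Set.Icc_subset_Icc_right hTN)
  have hIT : |∫ p in S T, g p| ≤ C * T ^ 2 := by
    rw [← hSvol T hT.le]
    exact norm_setIntegral_le_of_norm_le_const (hScomp T).measure_lt_top fun p _ => hC p
  have hdiff : |(∫ p in S N, g p) - ∫ p in S T, g p| ≤ C * (N ^ 2 - T ^ 2) := by
    rw [← setIntegral_sdiff (hScomp T).measurableSet
      (hg.continuousOn.integrableOn_compact (hScomp N)) hsub, ← hSvol T hT.le, ← hSvol N hN.le,
      ← measureReal_sdiff hsub (hScomp T).measurableSet (hScomp N).measure_lt_top.ne]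
    exact norm_setIntegral_le_of_norm_le_const
      ((measure_mono Set.sdiff_subset).trans_lt (hScomp N).measure_lt_top) fun p _ => hC p
  change |(1 / N ^ 2) * (∫ p in S N, g p) - (1 / T ^ 2) * ∫ p in S T, g p| ≤ _
  generalize (∫ p in S N, g p) = I at *
  generalize (∫ p in S T, g p) = J at *
  have hsplit : 1 / N ^ 2 * I - 1 / T ^ 2 * J =
      (I - J) / N ^ 2 - J * ((N ^ 2 - T ^ 2) / (N ^ 2 * T ^ 2)) := by
    field_simp
    ring
  have hNT2 : 0 ≤ N ^ 2 - T ^ 2 := by nlinarith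
  calc |1 / N ^ 2 * I - 1 / T ^ 2 * J|
      ≤ |I - J| / N ^ 2 + |J| * ((N ^ 2 - T ^ 2) / (N ^ 2 * T ^ 2)) := by
        rw [hsplit]
        refine (abs_sub _ _).trans_eq ?_
        rw [abs_div, abs_mul, abs_of_pos (show 0 < N ^ 2 by positivity),
          abs_of_nonneg (show 0 ≤ (N ^ 2 - T ^ 2) / (N ^ 2 * T ^ 2) by positivity)]
    _ ≤ C * (N ^ 2 - T ^ 2) / N ^ 2 + C * T ^ 2 * ((N ^ 2 - T ^ 2) / (N ^ 2 * T ^ 2)) := by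
        gcongr
    _ = C * (2 * (N ^ 2 - T ^ 2) / N ^ 2) := by
        field_simp
        ring
    _ ≤ C * (4 / T) := by
        refine mul_le_mul_of_nonneg_left ?_ hC0
        rw [div_le_div_iff₀ (by positivity) hT]
        have hsq : N ^ 2 - T ^ 2 ≤ 2 * N := by nlinarith
        nlinarith [mul_le_mul hsq hTN hT.le (by positivity)]
    _ = 4 * C / T := by ring

end Square

instance : IsTopologicalGroup (Matrix.SpecialLinearGroup (Fin 3) ℝ) :=
  Matrix.SpecialLinearGroup.topologicalGroup

theorem isClosedEmbedding_SL3_val : Topology.IsClosedEmbedding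
    ((↑) : Matrix.SpecialLinearGroup (Fin 3) ℝ → Matrix (Fin 3) (Fin 3) ℝ) :=
  Matrix.SpecialLinearGroup.isClosedEmbedding_val

instance : LocallyCompactSpace (Matrix.SpecialLinearGroup (Fin 3) ℝ) :=
  haveI : LocallyCompactSpace (Matrix (Fin 3) (Fin 3) ℝ) :=
    inferInstanceAs (LocallyCompactSpace (Fin 3 → Fin 3 → ℝ))
  isClosedEmbedding_SL3_val.locallyCompactSpace

instance : SecondCountableTopology (Matrix.SpecialLinearGroup (Fin 3) ℝ) :=
  haveI : SecondCountableTopology (Matrix (Fin 3) (Fin 3) ℝ) :=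
    inferInstanceAs (SecondCountableTopology (Fin 3 → Fin 3 → ℝ))
  isClosedEmbedding_SL3_val.isEmbedding.secondCountableTopology

instance : RegularSpace X := QuotientGroup.regularSpace SL3Z

theorem continuous_aSL : Continuous fun p : ℝ × ℝ => aSL p.1 p.2 := by
  refine isClosedEmbedding_SL3_val.isInducing.continuous_iff.2 ?_
  refine Continuous.matrix_diagonal (continuous_pi fun i => ?_)
  fin_cases i <;> simp <;> fun_prop

theorem aSL_add (s t s' t' : ℝ) : aSL (s + s') (t + t') = aSL s t * aSL s' t' := by
  refine Subtype.ext ?_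
  change Matrix.diagonal _ = Matrix.diagonal _ * Matrix.diagonal _
  rw [Matrix.diagonal_mul_diagonal]
  congr 1
  funext i
  fin_cases i <;> simp [← Real.exp_add]
  ring

theorem stmt14 (x : X) (T : ℕ → ℝ) (hTpos : ∀ k, 0 < T k) (hT : Tendsto T atTop atTop)
    (N : ℕ → ℕ) (hN : ∀ k, N k = ⌊T k⌋₊ + 1)
    (μ μ' : Measure X) [IsFiniteMeasure μ] [IsFiniteMeasure μ']
    (h1 : ∀ f : X → ℝ, Continuous f → Tendsto f (cocompact X) (nhds 0) →
      Tendsto (fun k : ℕ =>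
        (1 / (T k) ^ 2) *
          ∫ p in Set.Icc (0 : ℝ) (T k) ×ˢ Set.Icc (0 : ℝ) (T k), f (aSL p.1 p.2 • x))
        atTop (nhds (∫ y, f y ∂μ)))
    (h2 : ∀ f : X → ℝ, Continuous f → Tendsto f (cocompact X) (nhds 0) →
      Tendsto (fun k : ℕ =>
        (1 / (N k : ℝ) ^ 2) *
          ∑ m ∈ Finset.range (N k), ∑ n ∈ Finset.range (N k), f (aSL m n • x))
        atTop (nhds (∫ y, f y ∂μ'))) :
    (∀ f : X → ℝ, Continuous f → Tendsto f (cocompact X) (nhds 0) →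
      ∫ p in Set.Icc (0 : ℝ) 1 ×ˢ Set.Icc (0 : ℝ) 1, (∫ y, f (aSL p.1 p.2 • y) ∂μ') =
        ∫ y, f y ∂μ) ∧
    μ' Set.univ = μ Set.univ := by
  have hcompact : IsCompact (Set.Icc (0 : ℝ) 1 ×ˢ Set.Icc (0 : ℝ) 1) :=
    isCompact_Icc.prod isCompact_Icc
  have haction : Continuous fun q : (ℝ × ℝ) × X => aSL q.1.1 q.1.2 • q.2 :=
    (continuous_aSL.comp continuous_fst).smul continuous_snd
  have hmain : ∀ f : X → ℝ, Continuous f → Tendsto f (cocompact X) (nhds 0) →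
      ∫ y, (∫ p in Set.Icc (0 : ℝ) 1 ×ˢ Set.Icc (0 : ℝ) 1, f (aSL p.1 p.2 • y)) ∂μ' =
        ∫ y, f y ∂μ := by
    intro f hf hf_zero
    obtain ⟨C, hC⟩ := exists_forall_norm_le_of_tendsto_cocompact hf hf_zero
    have hg : Continuous fun p : ℝ × ℝ => f (aSL p.1 p.2 • x) :=
      hf.comp (continuous_aSL.smul continuous_const)
    have hN' := h2 _ (continuous_setIntegral_smul (ρ := volume) continuous_aSL hcompact hf)
      (tendsto_cocompact_setIntegral_smul (ρ := volume) continuous_aSL hcompact hf_zero)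
    have hdiff : Tendsto (fun k => 4 * C / T k) atTop (nhds 0) :=
      hT.const_div_atTop _
    refine tendsto_nhds_unique hN' ?_
    have hclose := squeeze_zero_norm (f := fun k : ℕ =>
      (1 / (N k : ℝ) ^ 2) * (∑ m ∈ Finset.range (N k), ∑ n ∈ Finset.range (N k),
        ∫ p in Set.Icc (0 : ℝ) 1 ×ˢ Set.Icc (0 : ℝ) 1, f (aSL p.1 p.2 • aSL m n • x)) -
      (1 / (T k) ^ 2) *
        ∫ p in Set.Icc (0 : ℝ) (T k) ×ˢ Set.Icc (0 : ℝ) (T k), f (aSL p.1 p.2 • x))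
      (fun k => ?_) hdiff
    · simpa using hclose.add (h1 f hf hf_zero)
    · have hsum := setIntegral_Icc_natCast_prod_eq_sum hg (N k)
      simp only [aSL_add, mul_smul] at hsum
      have hle : T k ≤ N k := by
        rw [hN]
        exact_mod_cast (Nat.lt_floor_add_one (T k)).le
      have hge : (N k : ℝ) ≤ T k + 1 := by
        rw [hN]
        push_cast
        gcongr
        exact Nat.floor_le (hTpos k).le
      rw [← hsum]
      exact abs_average_Icc_prod_sub_le hg (fun p => hC _) (hTpos k) hle hge
  have hν : IsFiniteMeasure
      ((volume : Measure (ℝ × ℝ)).restrict (Set.Icc (0 : ℝ) 1 ×ˢ Set.Icc (0 : ℝ) 1)) :=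
    ⟨by simpa using hcompact.measure_lt_top⟩
  have hfubini : ∀ f : X → ℝ, Continuous f → Tendsto f (cocompact X) (nhds 0) →
      Integrable (fun q : (ℝ × ℝ) × X => f (aSL q.1.1 q.1.2 • q.2))
        ((volume.restrict (Set.Icc (0 : ℝ) 1 ×ˢ Set.Icc (0 : ℝ) 1)).prod μ') := by
    intro f hf hf_zero
    obtain ⟨C, hC⟩ := exists_forall_norm_le_of_tendsto_cocompact hf hf_zero
    exact .of_bound (hf.comp haction).aestronglyMeasurable C (ae_of_all _ fun q => hC _)
  have hconv : ∀ f : X → ℝ, Continuous f → Tendsto f (cocompact X) (nhds 0) →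
      ∫ p in Set.Icc (0 : ℝ) 1 ×ˢ Set.Icc (0 : ℝ) 1, (∫ y, f (aSL p.1 p.2 • y) ∂μ') =
        ∫ y, f y ∂μ := by
    intro f hf hf_zero
    rw [← hmain f hf hf_zero]
    exact integral_integral_swap (hfubini f hf hf_zero)
  refine ⟨hconv, ?_⟩
  have hmass := measure_univ_eq_of_forall_integral_eq
    (((volume.restrict (Set.Icc (0 : ℝ) 1 ×ˢ Set.Icc (0 : ℝ) 1)).prod μ').map
      fun q : (ℝ × ℝ) × X => aSL q.1.1 q.1.2 • q.2) μ fun f hf hf_zero => by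
      rw [integral_map haction.measurable.aemeasurable hf.aestronglyMeasurable,
        integral_prod _ (hfubini f hf hf_zero), hconv f hf hf_zero]
  rw [← hmass, Measure.map_apply haction.measurable .univ, Set.preimage_univ,
    ← Set.univ_prod_univ, Measure.prod_prod, Measure.restrict_apply_univ,
    Measure.volume_eq_prod, Measure.prod_prod]
  simp
end

section
/- Let m_X be a Borel probability measure on X = SL(3,ℝ)/SL(3,ℤ) that is invariant under the left action of SL(3,ℝ). Let φ : ℝ³ → ℝ be a Borel measurable bounded function such that { v ∈ ℝ³ : φ(v) ≠ 0 } is bounded, and define the Siegel transform φ̂ : X → ℝ by φ̂(gΓ) = Σ_{v ∈ ℤ³ \ {0}} φ(g·v). Then φ̂ is integrable with respect to m_X and ∫_X φ̂ dm_X = ∫_{ℝ³} φ(v) dv, where dv is the Lebesgue measure on ℝ³. -/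
open Filter MeasureTheory Matrix

/-- The number of `i < m` with `α < i < β` is at most `β - α + 1`. -/
theorem card_filter_range_le (m : ℕ) {α β : ℝ} (h : α ≤ β) :
    (((Finset.range m).filter (fun i : ℕ => α < i ∧ (i : ℝ) < β)).card : ℝ) ≤ β - α + 1 := by
  have h1 : ((Finset.range m).filter (fun i : ℕ => α < i ∧ (i : ℝ) < β)).card
      ≤ (Finset.Ioo ⌊α⌋ ⌈β⌉).card := by
    apply Finset.card_le_card_of_injOn (fun i : ℕ => (i : ℤ))
    · intro i hi
      simp only [Finset.coe_filter, Finset.mem_range, Set.mem_ofPred_eq] at hi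
      simp only [Finset.coe_Ioo, Set.mem_Ioo, Int.floor_lt, Int.lt_ceil]
      exact_mod_cast hi.2
    · intro i _ j _ hij
      exact Int.natCast_inj.mp hij
  have h2 : (((Finset.range m).filter (fun i : ℕ => α < i ∧ (i : ℝ) < β)).card : ℝ)
      ≤ ((Finset.Ioo ⌊α⌋ ⌈β⌉).card : ℝ) := by exact_mod_cast h1
  refine h2.trans ?_
  rw [Int.card_Ioo]
  have h3 : (((⌈β⌉ - ⌊α⌋ - 1).toNat : ℤ) : ℝ) = ((max (⌈β⌉ - ⌊α⌋ - 1) 0 : ℤ) : ℝ) := by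
    rw [Int.toNat_eq_max]
  rw [Int.cast_natCast] at h3
  rw [h3]
  push_cast
  apply max_le
  · linarith [Int.ceil_lt_add_one β, Int.lt_floor_add_one α]
  · linarith

/-- If `0 ≤ α` and `β ≤ m`, the number of `i < m` with `α < i < β` is at least `β - α - 1`. -/
theorem le_card_filter_range (m : ℕ) {α β : ℝ} (hα : 0 ≤ α) (hβ : β ≤ m) :
    β - α - 1 ≤ (((Finset.range m).filter (fun i : ℕ => α < i ∧ (i : ℝ) < β)).card : ℝ) := by
  have h1 : (Finset.Ioo ⌊α⌋ ⌈β⌉).card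
      ≤ ((Finset.range m).filter (fun i : ℕ => α < i ∧ (i : ℝ) < β)).card := by
    apply Finset.card_le_card_of_injOn (fun i : ℤ => i.toNat)
    · intro i hi
      simp only [Finset.coe_Ioo, Set.mem_Ioo, Int.floor_lt, Int.lt_ceil] at hi
      have h0 : (0 : ℝ) < i := hα.trans_lt hi.1
      have h0' : 0 < i := by exact_mod_cast h0
      have hc : ((i.toNat : ℕ) : ℝ) = i := by
        have : ((i.toNat : ℕ) : ℤ) = i := Int.toNat_of_nonneg h0'.le
        exact_mod_cast congrArg (Int.cast : ℤ → ℝ) this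
      simp only [Finset.coe_filter, Finset.mem_range, Set.mem_ofPred_eq, hc]
      refine ⟨?_, hi⟩
      have : (i.toNat : ℝ) < m := by rw [hc]; linarith [hi.2]
      exact_mod_cast this
    · intro i hi j hj hij
      simp only [Finset.coe_Ioo, Set.mem_Ioo, Int.floor_lt, Int.lt_ceil] at hi hj
      have h0 : (0 : ℝ) < i := hα.trans_lt hi.1
      have h0' : 0 < i := by exact_mod_cast h0
      have g0 : (0 : ℝ) < j := hα.trans_lt hj.1
      have g0' : 0 < j := by exact_mod_cast g0
      simp only at hij
      omega
  have h2 : ((Finset.Ioo ⌊α⌋ ⌈β⌉).card : ℝ)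
      ≤ (((Finset.range m).filter (fun i : ℕ => α < i ∧ (i : ℝ) < β)).card : ℝ) := by
    exact_mod_cast h1
  refine le_trans ?_ h2
  rw [Int.card_Ioo]
  have h3 : (((⌈β⌉ - ⌊α⌋ - 1).toNat : ℤ) : ℝ) = ((max (⌈β⌉ - ⌊α⌋ - 1) 0 : ℤ) : ℝ) := by
    rw [Int.toNat_eq_max]
  rw [Int.cast_natCast] at h3
  rw [h3]
  push_cast
  apply le_max_of_le_left
  linarith [Int.le_ceil β, Int.floor_le α]

/-- The number of `i < (k + 1) ^ 4` for which the shear `y ↦ y + (i / (k + 1) ^ 4) * x` followed by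
dilation by `(k + 1) ^ 3` takes `y` into `(c, d)`. -/
noncomputable def shearCount (c d : ℝ) (k : ℕ) (x y : ℝ) : ℕ :=
  ((Finset.range ((k + 1) ^ 4)).filter (fun i : ℕ =>
    ((k : ℝ) + 1) ^ 3 * (y + i / ((k : ℝ) + 1) ^ 4 * x) ∈ Set.Ioo c d)).card

theorem shearCount_eq (c d : ℝ) (k : ℕ) {x : ℝ} (hx : 0 < x) (y : ℝ) :
    shearCount c d k x y = ((Finset.range ((k + 1) ^ 4)).filter (fun i : ℕ =>
      ((k : ℝ) + 1) ^ 4 * ((c / ((k : ℝ) + 1) ^ 3 - y) / x) < i ∧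
        (i : ℝ) < ((k : ℝ) + 1) ^ 4 * ((d / ((k : ℝ) + 1) ^ 3 - y) / x))).card := by
  have hk : (0 : ℝ) < (k : ℝ) + 1 := by positivity
  unfold shearCount
  congr 1
  ext i
  simp only [Finset.mem_filter, Set.mem_Ioo]
  have e1 : ((k : ℝ) + 1) ^ 3 * (y + i / ((k : ℝ) + 1) ^ 4 * x) - c =
      ((i : ℝ) - ((k : ℝ) + 1) ^ 4 * ((c / ((k : ℝ) + 1) ^ 3 - y) / x)) * (x / ((k : ℝ) + 1)) := by
    field_simp
    ring
  have e2 : d - ((k : ℝ) + 1) ^ 3 * (y + i / ((k : ℝ) + 1) ^ 4 * x) =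
      (((k : ℝ) + 1) ^ 4 * ((d / ((k : ℝ) + 1) ^ 3 - y) / x) - i) * (x / ((k : ℝ) + 1)) := by
    field_simp
    ring
  have hp : 0 < x / ((k : ℝ) + 1) := by positivity
  rw [← sub_pos (b := c), e1, ← sub_pos (a := d), e2, mul_pos_iff_of_pos_right hp,
    mul_pos_iff_of_pos_right hp, sub_pos, sub_pos]

theorem shearCount_le {c d : ℝ} (hcd : c < d) (k : ℕ) {x : ℝ} (hx : 0 < x) (y : ℝ) :
    (shearCount c d k x y : ℝ) / (k + 1) ≤ (d - c) / x + 1 / (k + 1) := by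
  have hk : (0 : ℝ) < (k : ℝ) + 1 := by positivity
  have h : ((k : ℝ) + 1) ^ 4 * ((c / ((k : ℝ) + 1) ^ 3 - y) / x) ≤
      ((k : ℝ) + 1) ^ 4 * ((d / ((k : ℝ) + 1) ^ 3 - y) / x) := by gcongr
  have := card_filter_range_le ((k + 1) ^ 4) h
  rw [← shearCount_eq c d k hx y] at this
  calc (shearCount c d k x y : ℝ) / (k + 1) ≤ (((k : ℝ) + 1) ^ 4 *
        ((d / ((k : ℝ) + 1) ^ 3 - y) / x) - ((k : ℝ) + 1) ^ 4 *
        ((c / ((k : ℝ) + 1) ^ 3 - y) / x) + 1) / (k + 1) := by gcongr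
    _ = (d - c) / x + 1 / (k + 1) := by
      field_simp
      ring

theorem tendsto_shearCount {c d : ℝ} (hcd : c < d) {x y : ℝ} (hx : 0 < x) (hy : y ≠ 0)
    (hxy : y ≠ -x) {u v : ℕ → ℝ} (hu : Tendsto u atTop (nhds x)) (hv : Tendsto v atTop (nhds y)) :
    Tendsto (fun k => (shearCount c d k (u k) (v k) : ℝ) / (k + 1)) atTop
      (nhds ((Set.Ioo (-x) 0).indicator (fun _ => (d - c) / x) y)) := by
  have hinv : Tendsto (fun k : ℕ => 1 / ((k : ℝ) + 1)) atTop (nhds 0) :=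
    tendsto_one_div_add_atTop_nhds_zero_nat
  have hlim : ∀ c : ℝ, Tendsto (fun k : ℕ => (c / ((k : ℝ) + 1) ^ 3 - v k) / u k) atTop
      (nhds (-y / x)) := by
    intro c
    have : Tendsto (fun k : ℕ => (c * (1 / ((k : ℝ) + 1)) ^ 3 - v k) / u k) atTop
        (nhds ((c * 0 ^ 3 - y) / x)) :=
      (((hinv.pow 3).const_mul c).sub hv).div hu hx.ne'
    have e : (c * 0 ^ 3 - y) / x = -y / x := by ring
    rw [e] at this
    refine this.congr fun k => ?_
    rw [one_div, inv_pow, div_eq_mul_inv c]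
  have hupos : ∀ᶠ k in atTop, 0 < u k := hu.eventually (lt_mem_nhds hx)
  by_cases hmem : y ∈ Set.Ioo (-x) 0
  · rw [Set.indicator_of_mem hmem]
    have hq0 : 0 < -y / x := div_pos (by linarith [hmem.2]) hx
    have hq1 : -y / x < 1 := by rw [div_lt_one hx]; linarith [hmem.1]
    have hmain : Tendsto (fun k => (d - c) / u k) atTop (nhds ((d - c) / x)) :=
      tendsto_const_nhds.div hu hx.ne'
    have hlow : Tendsto (fun k : ℕ => (d - c) / u k - 1 / ((k : ℝ) + 1)) atTop
        (nhds ((d - c) / x)) := by simpa using hmain.sub hinv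
    have hhigh : Tendsto (fun k : ℕ => (d - c) / u k + 1 / ((k : ℝ) + 1)) atTop
        (nhds ((d - c) / x)) := by simpa using hmain.add hinv
    refine tendsto_of_tendsto_of_tendsto_of_le_of_le' hlow hhigh ?_ ?_
    · filter_upwards [hupos, (hlim c).eventually (lt_mem_nhds hq0),
        (hlim d).eventually (gt_mem_nhds hq1)] with k h0 h1 h2
      have hk : (0 : ℝ) < (k : ℝ) + 1 := by positivity
      have hα : 0 ≤ ((k : ℝ) + 1) ^ 4 * ((c / ((k : ℝ) + 1) ^ 3 - v k) / u k) := by positivity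
      have hβ : ((k : ℝ) + 1) ^ 4 * ((d / ((k : ℝ) + 1) ^ 3 - v k) / u k)
          ≤ (((k + 1) ^ 4 : ℕ) : ℝ) := by
        push_cast
        have : (0 : ℝ) ≤ ((k : ℝ) + 1) ^ 4 := by positivity
        nlinarith
      have := le_card_filter_range ((k + 1) ^ 4) hα hβ
      rw [← shearCount_eq c d k h0 (v k)] at this
      calc (d - c) / u k - 1 / ((k : ℝ) + 1) = (((k : ℝ) + 1) ^ 4 *
            ((d / ((k : ℝ) + 1) ^ 3 - v k) / u k) - ((k : ℝ) + 1) ^ 4 *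
            ((c / ((k : ℝ) + 1) ^ 3 - v k) / u k) - 1) / (k + 1) := by
            field_simp
            ring
        _ ≤ _ := by gcongr
    · filter_upwards [hupos] with k h0
      exact shearCount_le hcd k h0 (v k)
  · rw [Set.indicator_of_notMem hmem]
    refine tendsto_const_nhds.congr' ?_
    suffices ∀ᶠ k in atTop, shearCount c d k (u k) (v k) = 0 by
      filter_upwards [this] with k hk
      simp [hk]
    rcases lt_or_gt_of_ne hy with hneg | hpos
    · have hlt : y < -x := by
        by_contra hcon
        exact hmem ⟨lt_of_le_of_ne (not_lt.mp hcon) hxy.symm, hneg⟩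
      have hq : 1 < -y / x := by rw [one_lt_div hx]; linarith
      filter_upwards [hupos, (hlim c).eventually (lt_mem_nhds hq)] with k h0 h1
      rw [shearCount_eq c d k h0, Finset.card_eq_zero, Finset.filter_eq_empty_iff]
      rintro i hi ⟨h2, -⟩
      have hi' : (i : ℝ) < ((k : ℝ) + 1) ^ 4 := by exact_mod_cast Finset.mem_range.mp hi
      have : (0 : ℝ) ≤ ((k : ℝ) + 1) ^ 4 := by positivity
      nlinarith
    · have hq : -y / x < 0 := div_neg_of_neg_of_pos (by linarith) hx
      filter_upwards [hupos, (hlim d).eventually (gt_mem_nhds hq)] with k h0 h1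
      rw [shearCount_eq c d k h0, Finset.card_eq_zero, Finset.filter_eq_empty_iff]
      rintro i hi ⟨-, h2⟩
      have hk : (0 : ℝ) < ((k : ℝ) + 1) ^ 4 := by positivity
      have hi' : (0 : ℝ) ≤ i := by positivity
      nlinarith

theorem lintegral_floor_mul {ι : Type*} [Fintype ι] (f : (ι → ℤ) → ENNReal) {t : ℝ} (ht : 0 < t) :
    ∫⁻ z : ι → ℝ, f (fun i => ⌊t * z i⌋) =
      ∑' v, f v * ENNReal.ofReal (1 / t) ^ Fintype.card ι := by
  have hm : Measurable (fun (z : ι → ℝ) (i : ι) => ⌊t * z i⌋) :=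
    measurable_pi_iff.mpr fun i => Int.measurable_floor.comp (by fun_prop)
  rw [← lintegral_map (μ := volume) (g := fun (z : ι → ℝ) (i : ι) => ⌊t * z i⌋)
    (Measurable.of_discrete (f := f)) hm, lintegral_countable']
  refine tsum_congr fun v => ?_
  rw [Measure.map_apply hm (measurableSet_singleton v)]
  have hpre : (fun (z : ι → ℝ) (i : ι) => ⌊t * z i⌋) ⁻¹' {v} =
      Set.univ.pi fun i => Set.Ico ((v i : ℝ) / t) ((v i + 1 : ℝ) / t) := by
    ext z
    simp only [Set.mem_preimage, Set.mem_singleton_iff, funext_iff, Int.floor_eq_iff, Set.mem_pi,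
      Set.mem_univ, true_imp_iff, Set.mem_Ico, div_le_iff₀ ht, lt_div_iff₀ ht, mul_comm t]
  rw [hpre, Real.volume_pi_Ico]
  congr 1
  rw [← Finset.card_univ, ← Finset.prod_const]
  refine Finset.prod_congr rfl fun i _ => ?_
  congr 1
  ring

/-- The open box `(a, b) × (c, d) × (e, f)`. -/
def openBox (a b c d e f : ℝ) : Set (Fin 3 → ℝ) :=
  {w | w 0 ∈ Set.Ioo a b ∧ w 1 ∈ Set.Ioo c d ∧ w 2 ∈ Set.Ioo e f}

/-- The product of the shear by `(i / (k + 1) ^ 4, j / (k + 1) ^ 4)` and of the diagonal matrix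
with entries `(k + 1) ^ (-2), k + 1, k + 1`. -/
noncomputable def shearDilation (k : ℕ) (p : ℕ × ℕ) : Matrix.SpecialLinearGroup (Fin 3) ℝ :=
  ⟨!![1 / ((k : ℝ) + 1) ^ 2, 0, 0;
      ((k : ℝ) + 1) * (p.1 / ((k : ℝ) + 1) ^ 4), (k : ℝ) + 1, 0;
      ((k : ℝ) + 1) * (p.2 / ((k : ℝ) + 1) ^ 4), 0, (k : ℝ) + 1], by
    have hk : (0 : ℝ) < (k : ℝ) + 1 := by positivity
    rw [Matrix.det_fin_three]
    simp
    field_simp⟩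

theorem shearDilation_mulVec_smul_mem_openBox (a b c d e f : ℝ) (k : ℕ) (p : ℕ × ℕ)
    (w : Fin 3 → ℝ) :
    (shearDilation k p : Matrix (Fin 3) (Fin 3) ℝ) *ᵥ (((k : ℝ) + 1) ^ 2 • w) ∈
      openBox a b c d e f ↔ w 0 ∈ Set.Ioo a b ∧
      ((k : ℝ) + 1) ^ 3 * (w 1 + p.1 / ((k : ℝ) + 1) ^ 4 * w 0) ∈ Set.Ioo c d ∧
      ((k : ℝ) + 1) ^ 3 * (w 2 + p.2 / ((k : ℝ) + 1) ^ 4 * w 0) ∈ Set.Ioo e f := by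
  have hk : (0 : ℝ) < (k : ℝ) + 1 := by positivity
  have h0 : ((shearDilation k p : Matrix (Fin 3) (Fin 3) ℝ) *ᵥ (((k : ℝ) + 1) ^ 2 • w)) 0 =
      w 0 := by
    simp [shearDilation, Matrix.mulVec, dotProduct, Fin.sum_univ_three]
    field_simp
  have h1 : ((shearDilation k p : Matrix (Fin 3) (Fin 3) ℝ) *ᵥ (((k : ℝ) + 1) ^ 2 • w)) 1 =
      ((k : ℝ) + 1) ^ 3 * (w 1 + p.1 / ((k : ℝ) + 1) ^ 4 * w 0) := by
    simp [shearDilation, Matrix.mulVec, dotProduct, Fin.sum_univ_three]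
    field_simp
    ring
  have h2 : ((shearDilation k p : Matrix (Fin 3) (Fin 3) ℝ) *ᵥ (((k : ℝ) + 1) ^ 2 • w)) 2 =
      ((k : ℝ) + 1) ^ 3 * (w 2 + p.2 / ((k : ℝ) + 1) ^ 4 * w 0) := by
    simp [shearDilation, Matrix.mulVec, dotProduct, Fin.sum_univ_three]
    field_simp
    ring
  simp only [openBox, Set.mem_ofPred_eq, h0, h1, h2]

/-- The rescaled average of the indicator of `openBox a b c d e f` over `shearDilation k`. -/
noncomputable def boxAverage (a b c d e f : ℝ) (k : ℕ) (w : Fin 3 → ℝ) : ℝ :=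
  (Set.Ioo a b).indicator (fun _ => 1) (w 0) * (shearCount c d k (w 0) (w 1) / (k + 1)) *
    (shearCount e f k (w 0) (w 2) / (k + 1))

theorem boxAverage_nonneg (a b c d e f : ℝ) (k : ℕ) (w : Fin 3 → ℝ) :
    0 ≤ boxAverage a b c d e f k w := by
  unfold boxAverage
  have : (0 : ℝ) ≤ (Set.Ioo a b).indicator (fun _ => 1) (w 0) :=
    Set.indicator_nonneg (fun _ _ => zero_le_one) _
  positivity

theorem average_indicator_openBox (a b c d e f : ℝ) (k : ℕ) (w : Fin 3 → ℝ) :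
    (((k + 1 : ℕ) : ENNReal) ^ 8)⁻¹ *
      ∑ p ∈ Finset.range ((k + 1) ^ 4) ×ˢ Finset.range ((k + 1) ^ 4),
        (openBox a b c d e f).indicator 1
          ((shearDilation k p : Matrix (Fin 3) (Fin 3) ℝ) *ᵥ (((k : ℝ) + 1) ^ 2 • w)) =
    ENNReal.ofReal (boxAverage a b c d e f k w) *
      ENNReal.ofReal (1 / ((k : ℝ) + 1) ^ 2) ^ Fintype.card (Fin 3) := by
  classical
  have hk : (0 : ℝ) < (k : ℝ) + 1 := by positivity
  have hL : ((k + 1 : ℕ) : ENNReal) = ENNReal.ofReal ((k : ℝ) + 1) := by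
    rw [← ENNReal.ofReal_natCast]; push_cast; rfl
  have hsum : ∑ p ∈ Finset.range ((k + 1) ^ 4) ×ˢ Finset.range ((k + 1) ^ 4),
        (openBox a b c d e f).indicator (1 : (Fin 3 → ℝ) → ENNReal)
          ((shearDilation k p : Matrix (Fin 3) (Fin 3) ℝ) *ᵥ (((k : ℝ) + 1) ^ 2 • w)) =
      ENNReal.ofReal ((Set.Ioo a b).indicator (fun _ => 1) (w 0) *
        shearCount c d k (w 0) (w 1) * shearCount e f k (w 0) (w 2)) := by
    simp only [Set.indicator_apply, shearDilation_mulVec_smul_mem_openBox, Pi.one_apply]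
    by_cases h0 : w 0 ∈ Set.Ioo a b
    · simp only [h0, true_and, if_true, one_mul]
      rw [← Nat.cast_mul, ENNReal.ofReal_natCast, shearCount, shearCount, ← Finset.card_product,
        ← Finset.filter_product, Finset.sum_boole]
    · simp [h0]
  rw [hsum, hL, ← ENNReal.ofReal_pow hk.le, ← ENNReal.ofReal_inv_of_pos (by positivity),
    ← ENNReal.ofReal_mul (by positivity), ← ENNReal.ofReal_pow (by positivity),
    ← ENNReal.ofReal_mul (boxAverage_nonneg ..), Fintype.card_fin]
  congr 1
  unfold boxAverage
  field_simp

theorem boxAverage_le {a b c d e f : ℝ} (ha : 0 < a) (hcd : c < d) (hef : e < f) (k : ℕ)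
    (w : Fin 3 → ℝ) :
    boxAverage a b c d e f k w ≤
      (Metric.closedBall 0 (|b| + |c| + |d| + |e| + |f|)).indicator
        (fun _ => ((d - c) / a + 1) * ((f - e) / a + 1)) w := by
  have hk : (0 : ℝ) < (k : ℝ) + 1 := by positivity
  have hk1 : 1 / ((k : ℝ) + 1) ≤ 1 := by
    rw [div_le_one hk]; linarith [Nat.cast_nonneg (α := ℝ) k]
  have hdc : 0 < (d - c) / a := div_pos (by linarith) ha
  have hfe : 0 < (f - e) / a := div_pos (by linarith) ha
  have hR : ∀ r : ℝ, 0 ≤ (Metric.closedBall (0 : Fin 3 → ℝ) r).indicator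
      (fun _ => ((d - c) / a + 1) * ((f - e) / a + 1)) w :=
    fun r => Set.indicator_nonneg (fun _ _ => by positivity) _
  by_cases h0 : w 0 ∈ Set.Ioo a b
  swap
  · simpa [boxAverage, h0] using hR _
  have hpos : 0 < w 0 := ha.trans h0.1
  have hbound : ∀ c d y : ℝ, shearCount c d k (w 0) y ≠ 0 → |y| ≤ |b| + |c| + |d| := by
    intro c d y hne
    obtain ⟨i, hi⟩ := Finset.card_ne_zero.mp hne
    rw [Finset.mem_filter, Finset.mem_range] at hi
    obtain ⟨hi, h1, h2⟩ := hi
    have hi' : (i : ℝ) < ((k : ℝ) + 1) ^ 4 := by exact_mod_cast hi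
    set q : ℝ := i / ((k : ℝ) + 1) ^ 4 with hq
    have hq0 : 0 ≤ q := by positivity
    have hq1 : q ≤ 1 := by
      rw [hq, div_le_one (by positivity)]; exact hi'.le
    have hqw : q * w 0 ≤ b := by nlinarith [h0.2]
    have hqw0 : 0 ≤ q * w 0 := by positivity
    have hM : (1 : ℝ) ≤ ((k : ℝ) + 1) ^ 3 := one_le_pow₀ (by linarith [Nat.cast_nonneg (α := ℝ) k])
    set M := ((k : ℝ) + 1) ^ 3
    have hz : |y + q * w 0| ≤ |c| + |d| := by
      have : |M * (y + q * w 0)| ≤ |c| + |d| := by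
        rw [abs_le]
        constructor
        · linarith [neg_abs_le c, abs_nonneg d]
        · linarith [le_abs_self d, abs_nonneg c]
      rw [abs_mul, abs_of_pos (by linarith : 0 < M)] at this
      nlinarith [abs_nonneg (y + q * w 0)]
    rw [abs_le] at hz ⊢
    constructor
    · linarith [le_abs_self b]
    · linarith [abs_nonneg b]
  have hle : ∀ c d y : ℝ, c < d → (shearCount c d k (w 0) y : ℝ) / (k + 1) ≤ (d - c) / a + 1 := by
    intro c d y hcd
    refine (shearCount_le hcd k hpos y).trans ?_
    have : (d - c) / w 0 ≤ (d - c) / a :=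
      div_le_div_of_nonneg_left (by linarith) ha h0.1.le
    linarith
  by_cases h1 : shearCount c d k (w 0) (w 1) = 0
  · simpa [boxAverage, h1] using hR _
  by_cases h2 : shearCount e f k (w 0) (w 2) = 0
  · simpa [boxAverage, h2] using hR _
  rw [Set.indicator_of_mem]
  · unfold boxAverage
    rw [Set.indicator_of_mem h0, one_mul]
    exact mul_le_mul (hle _ _ _ hcd) (hle _ _ _ hef) (by positivity) (by positivity)
  · rw [mem_closedBall_zero_iff, pi_norm_le_iff_of_nonneg (by positivity)]
    have h1' := hbound _ _ _ h1
    have h2' := hbound _ _ _ h2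
    have h0' : |w 0| ≤ |b| := by
      rw [abs_of_pos hpos]; exact h0.2.le.trans (le_abs_self b)
    intro i
    rw [Real.norm_eq_abs]
    fin_cases i
    · change |w 0| ≤ _
      linarith [abs_nonneg c, abs_nonneg d, abs_nonneg e, abs_nonneg f]
    · change |w 1| ≤ _
      linarith [abs_nonneg e, abs_nonneg f]
    · change |w 2| ≤ _
      linarith [abs_nonneg c, abs_nonneg d]

/-- The pointwise limit of `boxAverage`. -/
noncomputable def boxLimit (a b c d e f : ℝ) (w : Fin 3 → ℝ) : ℝ :=
  (Set.Ioo a b).indicator (fun _ => 1) (w 0) *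
    (Set.Ioo (-w 0) 0).indicator (fun _ => (d - c) / w 0) (w 1) *
    (Set.Ioo (-w 0) 0).indicator (fun _ => (f - e) / w 0) (w 2)

theorem tendsto_boxAverage {a b c d e f : ℝ} (ha : 0 < a) (hcd : c < d) (hef : e < f)
    {w : Fin 3 → ℝ} {u : ℕ → Fin 3 → ℝ} (hu : Tendsto u atTop (nhds w)) (h0a : w 0 ≠ a)
    (h0b : w 0 ≠ b) (h1 : w 1 ≠ 0) (h1' : w 1 ≠ -w 0) (h2 : w 2 ≠ 0) (h2' : w 2 ≠ -w 0) :
    Tendsto (fun k => boxAverage a b c d e f k (u k)) atTop (nhds (boxLimit a b c d e f w)) := by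
  have hu' := tendsto_pi_nhds.mp hu
  by_cases h0 : w 0 ∈ Set.Ioo a b
  · have hpos : 0 < w 0 := ha.trans h0.1
    refine (Tendsto.mul ?_ (tendsto_shearCount hcd hpos h1 h1' (hu' 0) (hu' 1))).mul
      (tendsto_shearCount hef hpos h2 h2' (hu' 0) (hu' 2))
    rw [Set.indicator_of_mem h0]
    refine tendsto_const_nhds.congr' ?_
    filter_upwards [(hu' 0).eventually (isOpen_Ioo.mem_nhds h0)] with k hk
    rw [Set.indicator_of_mem (show u k 0 ∈ Set.Ioo a b from hk)]
  · have h0c : w 0 ∈ (Set.Icc a b)ᶜ := fun h =>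
      h0 ⟨lt_of_le_of_ne h.1 h0a.symm, lt_of_le_of_ne h.2 h0b⟩
    have : boxLimit a b c d e f w = 0 := by simp [boxLimit, h0]
    rw [this]
    refine tendsto_const_nhds.congr' ?_
    filter_upwards [(hu' 0).eventually (isClosed_Icc.isOpen_compl.mem_nhds h0c)] with k hk
    have : u k 0 ∉ Set.Ioo a b := fun h => hk (Set.Ioo_subset_Icc_self h)
    rw [boxAverage, Set.indicator_of_notMem this, zero_mul, zero_mul]

theorem lintegral_boxLimit {a b c d e f : ℝ} (ha : 0 < a) (hcd : c < d) (hef : e < f) :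
    ∫⁻ w, ENNReal.ofReal (boxLimit a b c d e f w) =
      ENNReal.ofReal (b - a) * ENNReal.ofReal (d - c) * ENNReal.ofReal (f - e) := by
  have hmp := measurePreserving_piFinSuccAbove (fun _ : Fin 3 => (volume : Measure ℝ)) 0
  have hset : MeasurableSet {q : ℝ × (Fin 2 → ℝ) | q.1 ∈ Set.Ioo a b ∧
      q.2 0 ∈ Set.Ioo (-q.1) 0 ∧ q.2 1 ∈ Set.Ioo (-q.1) 0} := by
    have m1 : Measurable fun q : ℝ × (Fin 2 → ℝ) => q.1 := measurable_fst
    have m2 : ∀ i, Measurable fun q : ℝ × (Fin 2 → ℝ) => q.2 i :=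
      fun i => (measurable_pi_apply i).comp measurable_snd
    simp only [Set.mem_Ioo]
    measurability
  let h : ℝ × (Fin 2 → ℝ) → ENNReal := {q : ℝ × (Fin 2 → ℝ) | q.1 ∈ Set.Ioo a b ∧
      q.2 0 ∈ Set.Ioo (-q.1) 0 ∧ q.2 1 ∈ Set.Ioo (-q.1) 0}.indicator
      fun q => ENNReal.ofReal ((d - c) / q.1 * ((f - e) / q.1))
  have hmeas : Measurable h := by
    refine Measurable.indicator ?_ hset
    fun_prop
  have hh : ∀ w : Fin 3 → ℝ, ENNReal.ofReal (boxLimit a b c d e f w) =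
      h (MeasurableEquiv.piFinSuccAbove (fun _ => ℝ) 0 w) := by
    intro w
    change _ = h (w 0, fun j => w (Fin.succAbove 0 j))
    simp only [boxLimit, h, Set.indicator_apply, Set.mem_ofPred_eq]
    by_cases h0 : w 0 ∈ Set.Ioo a b <;> by_cases h1 : w 1 ∈ Set.Ioo (-w 0) 0 <;>
      by_cases h2 : w 2 ∈ Set.Ioo (-w 0) 0 <;> simp [h0, h1, h2]
  simp_rw [hh]
  rw [show (volume : Measure (Fin 3 → ℝ)) = Measure.pi fun _ => volume from rfl,
    hmp.lintegral_comp hmeas, lintegral_prod _ hmeas.aemeasurable]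
  have hinner : ∀ x : ℝ, ∫⁻ y : Fin 2 → ℝ, h (x, y) ∂(Measure.pi fun _ => volume) =
      (Set.Ioo a b).indicator (fun _ => ENNReal.ofReal (d - c) * ENNReal.ofReal (f - e)) x := by
    intro x
    by_cases hx : x ∈ Set.Ioo a b
    · have hpos : 0 < x := ha.trans hx.1
      have : ∀ y : Fin 2 → ℝ, h (x, y) = (Set.univ.pi fun _ => Set.Ioo (-x) 0).indicator
          (fun _ => ENNReal.ofReal ((d - c) / x * ((f - e) / x))) y := by
        intro y
        classical
        simp only [h, Set.indicator_apply, Set.mem_ofPred_eq, hx, true_and, Set.mem_pi,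
          Set.mem_univ, true_imp_iff, Fin.forall_fin_two]
      simp_rw [this]
      rw [← volume_pi, lintegral_indicator_const
        (MeasurableSet.univ_pi fun _ => measurableSet_Ioo), Real.volume_pi_Ioo,
        Set.indicator_of_mem hx, Fin.prod_univ_two, ← ENNReal.ofReal_mul (by linarith),
        ← ENNReal.ofReal_mul (p := d - c) (by linarith), ← ENNReal.ofReal_mul]
      · congr 1
        field_simp
        ring
      · have : 0 < d - c := by linarith
        have : 0 < f - e := by linarith
        positivity
    · have : ∀ y : Fin 2 → ℝ, h (x, y) = 0 := fun y =>
        Set.indicator_of_notMem (fun hq => hx hq.1) _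
      simp [this, hx]
  have : ∀ x : ℝ, ∫⁻ y : Fin 2 → ℝ, h (x, y)
      ∂(Measure.pi fun j => (fun _ : Fin 3 => (volume : Measure ℝ)) (Fin.succAbove 0 j)) =
      (Set.Ioo a b).indicator (fun _ => ENNReal.ofReal (d - c) * ENNReal.ofReal (f - e)) x := hinner
  simp_rw [this]
  rw [lintegral_indicator_const measurableSet_Ioo, Real.volume_Ioo]
  ring

theorem measurePreserving_mulVec (g : Matrix.SpecialLinearGroup (Fin 3) ℝ) :
    MeasurePreserving (fun w => (g : Matrix (Fin 3) (Fin 3) ℝ) *ᵥ w) volume volume := by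
  refine ⟨(Continuous.matrix_mulVec continuous_const continuous_id).measurable, ?_⟩
  have h := Real.map_matrix_volume_pi_eq_smul_volume_pi (M := (g : Matrix (Fin 3) (Fin 3) ℝ))
    (by simp)
  rw [g.det_coe, inv_one, abs_one, ENNReal.ofReal_one, one_smul] at h
  exact h

theorem ae_ne_boundary (a b : ℝ) :
    ∀ᵐ w : Fin 3 → ℝ, w 0 ≠ a ∧ w 0 ≠ b ∧ w 1 ≠ 0 ∧ w 1 ≠ -w 0 ∧ w 2 ≠ 0 ∧ w 2 ≠ -w 0 := by
  have hpl : ∀ (i : Fin 3) (r : ℝ), ∀ᵐ w : Fin 3 → ℝ, w i ≠ r := by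
    intro i r
    rw [ae_iff]
    simp only [ne_eq, not_not]
    exact Measure.pi_hyperplane (fun _ : Fin 3 => (volume : Measure ℝ)) i r
  have hdiag : ∀ i : Fin 3, i ≠ 0 → ∀ᵐ w : Fin 3 → ℝ, w i ≠ -w 0 := by
    intro i hi
    let ℓ : (Fin 3 → ℝ) →ₗ[ℝ] ℝ := LinearMap.proj (R := ℝ) (φ := fun _ => ℝ) i + LinearMap.proj 0
    have hker : LinearMap.ker ℓ ≠ ⊤ := by
      rw [Ne, LinearMap.ker_eq_top]
      intro h
      have := LinearMap.congr_fun h (Pi.single i 1)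
      simp [ℓ, hi.symm] at this
    have := Measure.addHaar_submodule (volume : Measure (Fin 3 → ℝ)) _ hker
    rw [ae_iff]
    convert this using 2
    ext w
    simp [ℓ, eq_neg_iff_add_eq_zero]
  filter_upwards [hpl 0 a, hpl 0 b, hpl 1 0, hpl 2 0, hdiag 1 (by decide), hdiag 2 (by decide)]
    with w h1 h2 h3 h4 h5 h6 using ⟨h1, h2, h3, h5, h4, h6⟩

theorem norm_floor_div_sub_le {ι : Type*} [Fintype ι] {t : ℝ} (ht : 0 < t) (z : ι → ℝ) :
    ‖(fun i => (⌊t * z i⌋ : ℝ) / t) - z‖ ≤ 1 / t := by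
  rw [pi_norm_le_iff_of_nonneg (by positivity)]
  intro i
  rw [Pi.sub_apply, Real.norm_eq_abs, abs_le]
  have h1 := Int.floor_le (t * z i)
  have h2 := Int.lt_floor_add_one (t * z i)
  have e : (⌊t * z i⌋ : ℝ) / t - z i = (⌊t * z i⌋ - t * z i) / t := by field_simp
  rw [e]
  constructor
  · rw [← neg_div, div_le_div_iff_of_pos_right ht]; linarith
  · rw [div_le_div_iff_of_pos_right ht]; linarith

theorem tendsto_average_openBox {a b c d e f : ℝ} (ha : 0 < a) (hcd : c < d) (hef : e < f)
    (g : Matrix.SpecialLinearGroup (Fin 3) ℝ) :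
    Tendsto (fun k : ℕ => (((k + 1 : ℕ) : ENNReal) ^ 8)⁻¹ *
      ∑ p ∈ Finset.range ((k + 1) ^ 4) ×ˢ Finset.range ((k + 1) ^ 4),
        ∑' v : Fin 3 → ℤ, (openBox a b c d e f).indicator (1 : (Fin 3 → ℝ) → ENNReal)
          ((shearDilation k p : Matrix (Fin 3) (Fin 3) ℝ) *ᵥ
            ((g : Matrix (Fin 3) (Fin 3) ℝ) *ᵥ fun i => (v i : ℝ)))) atTop
      (nhds (ENNReal.ofReal (b - a) * ENNReal.ofReal (d - c) * ENNReal.ofReal (f - e))) := by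
  let A : Matrix (Fin 3) (Fin 3) ℝ := g
  let t : ℕ → ℝ := fun k => ((k : ℝ) + 1) ^ 2
  have ht : ∀ k, 0 < t k := fun k => by positivity
  have ht1 : ∀ k, 1 / t k ≤ 1 := fun k => by
    rw [div_le_one (ht k)]
    exact one_le_pow₀ (by linarith [Nat.cast_nonneg (α := ℝ) k])
  let r : ℕ → (Fin 3 → ℝ) → (Fin 3 → ℝ) := fun k z i => (⌊t k * z i⌋ : ℝ) / t k
  have hrw : ∀ k : ℕ, (((k + 1 : ℕ) : ENNReal) ^ 8)⁻¹ *
      ∑ p ∈ Finset.range ((k + 1) ^ 4) ×ˢ Finset.range ((k + 1) ^ 4),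
        ∑' v : Fin 3 → ℤ, (openBox a b c d e f).indicator (1 : (Fin 3 → ℝ) → ENNReal)
          ((shearDilation k p : Matrix (Fin 3) (Fin 3) ℝ) *ᵥ (A *ᵥ fun i => (v i : ℝ))) =
      ∫⁻ z, ENNReal.ofReal (boxAverage a b c d e f k (A *ᵥ r k z)) := by
    intro k
    rw [lintegral_floor_mul (fun v : Fin 3 → ℤ => ENNReal.ofReal (boxAverage a b c d e f k
      (A *ᵥ fun i => (v i : ℝ) / t k))) (ht k), ← Summable.tsum_finsetSum
      (fun _ _ => ENNReal.summable), ← ENNReal.tsum_mul_left]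
    refine tsum_congr fun v => ?_
    have hv : A *ᵥ (fun i => (v i : ℝ)) = t k • (A *ᵥ fun i => (v i : ℝ) / t k) := by
      rw [← Matrix.mulVec_smul]
      congr 1
      ext i
      rw [Pi.smul_apply, smul_eq_mul]
      have := (ht k).ne'
      field_simp
    rw [hv]
    exact average_indicator_openBox a b c d e f k (A *ᵥ fun i => (v i : ℝ) / t k)
  rw [← lintegral_boxLimit ha hcd hef,
    ← (measurePreserving_mulVec g).lintegral_comp_emb
      (MeasurableEquiv.measurableEmbedding
        (Matrix.SpecialLinearGroup.toLin' g).toContinuousLinearEquiv.toHomeomorph.toMeasurableEquiv)]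
  refine Tendsto.congr (fun k => (hrw k).symm) ?_
  set R : ℝ := |b| + |c| + |d| + |e| + |f|
  set C : ℝ := ((d - c) / a + 1) * ((f - e) / a + 1)
  let T := LinearMap.toContinuousLinearMap (Matrix.toLin' (A⁻¹))
  have hT : ∀ w, A⁻¹ *ᵥ w = T w := fun w => by simp [T]
  have hcanc : ∀ w, A⁻¹ *ᵥ (A *ᵥ w) = w := fun w => by
    rw [Matrix.mulVec_mulVec, Matrix.nonsing_inv_mul _ (by simp [A]), Matrix.one_mulVec]
  have hrz : ∀ k z, ‖r k z - z‖ ≤ 1 / t k := fun k z => norm_floor_div_sub_le (ht k) z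
  refine tendsto_lintegral_of_dominated_convergence
    ((Metric.closedBall 0 (‖T‖ * R + 1)).indicator fun _ => ENNReal.ofReal C) ?_ ?_ ?_ ?_
  · intro k
    have hm : Measurable fun (z : Fin 3 → ℝ) (i : Fin 3) => ⌊t k * z i⌋ :=
      measurable_pi_iff.mpr fun i => Int.measurable_floor.comp (by fun_prop)
    exact (Measurable.of_discrete (f := fun v : Fin 3 → ℤ => ENNReal.ofReal
      (boxAverage a b c d e f k (A *ᵥ fun i => (v i : ℝ) / t k)))).comp hm
  · intro k
    refine ae_of_all _ fun z => ?_
    have hle := boxAverage_le (b := b) ha hcd hef k (A *ᵥ r k z)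
    by_cases hz : A *ᵥ r k z ∈ Metric.closedBall (0 : Fin 3 → ℝ) R
    · rw [Set.indicator_of_mem hz] at hle
      rw [Set.indicator_of_mem]
      · exact ENNReal.ofReal_le_ofReal hle
      · rw [mem_closedBall_zero_iff] at hz ⊢
        have h1 : ‖r k z‖ ≤ ‖T‖ * R := by
          rw [← hcanc (r k z), hT]
          exact T.le_of_opNorm_le_of_le le_rfl hz
        have h2 := (hrz k z).trans (ht1 k)
        rw [norm_sub_rev] at h2
        calc ‖z‖ = ‖r k z + (z - r k z)‖ := by congr 1; abel
          _ ≤ _ := norm_add_le_of_le h1 h2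
    · rw [Set.indicator_of_notMem hz] at hle
      exact (ENNReal.ofReal_of_nonpos hle).trans_le zero_le
  · rw [lintegral_indicator_const Metric.isClosed_closedBall.measurableSet]
    exact ENNReal.mul_ne_top ENNReal.ofReal_ne_top measure_closedBall_lt_top.ne
  · have hae := (measurePreserving_mulVec g).quasiMeasurePreserving.ae (ae_ne_boundary a b)
    filter_upwards [hae] with z hz
    refine (ENNReal.continuous_ofReal.tendsto _).comp ?_
    refine tendsto_boxAverage ha hcd hef ?_ hz.1 hz.2.1 hz.2.2.1 hz.2.2.2.1 hz.2.2.2.2.1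
      hz.2.2.2.2.2
    have hrlim : Tendsto (fun k => r k z) atTop (nhds z) := by
      rw [tendsto_iff_norm_sub_tendsto_zero]
      refine squeeze_zero (fun _ => norm_nonneg _) (fun k => hrz k z) ?_
      have := (tendsto_one_div_add_atTop_nhds_zero_nat (𝕜 := ℝ)).pow 2
      simpa [t] using this
    exact ((Continuous.matrix_mulVec (A := fun _ : Fin 3 → ℝ => A) continuous_const
      continuous_id).tendsto z).comp hrlim

/-- If the averages of `h` along finite families of measure-preserving maps converge pointwise to a
finite constant, then the integral of `h` is that constant. -/
theorem lintegral_eq_of_tendsto_average {α ι : Type*} [MeasurableSpace α] {m : Measure α}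
    [IsProbabilityMeasure m] {h : α → ENNReal} (hh : Measurable h) (s : ℕ → Finset ι)
    (W : ℕ → ENNReal) (hW : ∀ k, W k * (s k).card = 1) (T : ℕ → ι → α → α)
    (hT : ∀ k p, MeasurePreserving (T k p) m m) {c : ENNReal}
    (hlim : ∀ x, Tendsto (fun k => W k * ∑ p ∈ s k, h (T k p x)) atTop (nhds c)) :
    ∫⁻ x, h x ∂m = c := by
  have havg : ∀ (k : ℕ) (f : α → ENNReal), Measurable f →
      ∫⁻ x, W k * ∑ p ∈ s k, f (T k p x) ∂m = ∫⁻ x, f x ∂m := by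
    intro k f hf
    have hfm : ∀ p ∈ s k, Measurable fun x => f (T k p x) :=
      fun p _ => hf.comp (hT k p).measurable
    rw [lintegral_const_mul _ (Finset.measurable_fun_sum _ hfm), lintegral_finsetSum _ hfm,
      Finset.sum_congr rfl fun p _ => (hT k p).lintegral_comp hf, Finset.sum_const, nsmul_eq_mul,
      ← mul_assoc, hW, one_mul]
  have hmeas : ∀ k, Measurable fun x => W k * ∑ p ∈ s k, h (T k p x) := fun k =>
    (Finset.measurable_fun_sum _ fun p _ => hh.comp (hT k p).measurable).const_mul _
  apply le_antisymm
  · have hmin : ∀ M : ℕ, ∫⁻ x, min (h x) M ∂m ≤ c := by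
      intro M
      have hle : ∀ k, ∫⁻ x, min (h x) M ∂m ≤
          ∫⁻ x, min (W k * ∑ p ∈ s k, h (T k p x)) M ∂m := by
        intro k
        rw [← havg k _ (hh.min measurable_const)]
        refine lintegral_mono fun x => le_min ?_ ?_
        · gcongr
          exact min_le_left _ _
        · calc W k * ∑ p ∈ s k, min (h (T k p x)) M ≤ W k * ∑ p ∈ s k, (M : ENNReal) := by
                gcongr
                exact min_le_right _ _
            _ = M := by rw [Finset.sum_const, nsmul_eq_mul, ← mul_assoc, hW, one_mul]
      have hdom : Tendsto (fun k => ∫⁻ x, min (W k * ∑ p ∈ s k, h (T k p x)) M ∂m) atTop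
          (nhds (∫⁻ _, min c M ∂m)) := by
        refine tendsto_lintegral_of_dominated_convergence (fun _ => (M : ENNReal))
          (fun k => (hmeas k).min measurable_const)
          (fun k => ae_of_all _ fun x => min_le_right _ _) (by simp)
          (ae_of_all _ fun x => (hlim x).min tendsto_const_nhds)
      refine (ge_of_tendsto' hdom hle).trans ?_
      simp
    have hsup : ∀ x, h x = ⨆ M : ℕ, min (h x) M := by
      intro x
      apply le_antisymm
      · rw [← inf_iSup_eq, ENNReal.iSup_natCast]
        simp
      · exact iSup_le fun M => min_le_left _ _
    rw [lintegral_congr hsup, lintegral_iSup (fun M => hh.min measurable_const)]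
    · exact iSup_le hmin
    · intro M N hMN x
      exact min_le_min_left _ (by exact_mod_cast hMN)
  · calc c = ∫⁻ x, liminf (fun k => W k * ∑ p ∈ s k, h (T k p x)) atTop ∂m := by
          rw [lintegral_congr fun x => (hlim x).liminf_eq]
          simp
      _ ≤ liminf (fun k => ∫⁻ x, W k * ∑ p ∈ s k, h (T k p x) ∂m) atTop :=
          lintegral_liminf_le hmeas
      _ = ∫⁻ x, h x ∂m := by simp [havg _ h hh]

/-- The counting measure on the nonzero vectors of the lattice `g • ℤ³`. -/
noncomputable def latticeMeasure (g : Matrix.SpecialLinearGroup (Fin 3) ℝ) :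
    Measure (Fin 3 → ℝ) :=
  Measure.sum fun v : {v : Fin 3 → ℤ // v ≠ 0} =>
    Measure.dirac ((g : Matrix (Fin 3) (Fin 3) ℝ) *ᵥ fun i => ((v : Fin 3 → ℤ) i : ℝ))

theorem latticeMeasure_apply (g : Matrix.SpecialLinearGroup (Fin 3) ℝ) {s : Set (Fin 3 → ℝ)}
    (hs : MeasurableSet s) :
    latticeMeasure g s = ∑' v : {v : Fin 3 → ℤ // v ≠ 0}, s.indicator 1
      ((g : Matrix (Fin 3) (Fin 3) ℝ) *ᵥ fun i => ((v : Fin 3 → ℤ) i : ℝ)) := by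
  rw [latticeMeasure, Measure.sum_apply _ hs]
  exact tsum_congr fun v => Measure.dirac_apply' _ hs

theorem latticeMeasure_apply_of_zero_notMem (g : Matrix.SpecialLinearGroup (Fin 3) ℝ)
    {s : Set (Fin 3 → ℝ)} (hs : MeasurableSet s) (h0 : (0 : Fin 3 → ℝ) ∉ s) :
    latticeMeasure g s = ∑' v : Fin 3 → ℤ, s.indicator 1
      ((g : Matrix (Fin 3) (Fin 3) ℝ) *ᵥ fun i => (v i : ℝ)) := by
  rw [latticeMeasure_apply g hs]
  refine tsum_subtype_eq_of_support_subset (s := {v : Fin 3 → ℤ | v ≠ 0})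
    (f := fun v => s.indicator (1 : (Fin 3 → ℝ) → ENNReal)
      ((g : Matrix (Fin 3) (Fin 3) ℝ) *ᵥ fun i => (v i : ℝ))) ?_
  rintro v hv rfl
  apply hv
  have : (fun i => (((0 : Fin 3 → ℤ) i : ℤ) : ℝ)) = (0 : Fin 3 → ℝ) := by ext i; simp
  simp only [this, Matrix.mulVec_zero]
  exact Set.indicator_of_notMem h0 _

theorem latticeMeasure_mul (h g : Matrix.SpecialLinearGroup (Fin 3) ℝ) :
    latticeMeasure (h * g) =
      (latticeMeasure g).map fun w => (h : Matrix (Fin 3) (Fin 3) ℝ) *ᵥ w := by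
  ext s hs
  have hm := (measurePreserving_mulVec h).measurable
  rw [Measure.map_apply hm hs, latticeMeasure_apply _ hs, latticeMeasure_apply _ (hm hs)]
  refine tsum_congr fun v => ?_
  rw [Matrix.SpecialLinearGroup.coe_mul, ← Matrix.mulVec_mulVec]
  rfl

theorem latticeMeasure_mul_of_mem (g γ : Matrix.SpecialLinearGroup (Fin 3) ℝ) (hγ : γ ∈ SL3Z) :
    latticeMeasure (g * γ) = latticeMeasure g := by
  obtain ⟨A, rfl⟩ := hγ
  let e : {v : Fin 3 → ℤ // v ≠ 0} ≃ {v : Fin 3 → ℤ // v ≠ 0} :=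
    (Matrix.SpecialLinearGroup.toLin' A).toEquiv.subtypeEquiv fun v => by simp
  ext s hs
  rw [latticeMeasure_apply _ hs, latticeMeasure_apply _ hs]
  refine Eq.trans ?_ (e.tsum_eq fun v : {v : Fin 3 → ℤ // v ≠ 0} => s.indicator 1
    ((g : Matrix (Fin 3) (Fin 3) ℝ) *ᵥ fun i => ((v : Fin 3 → ℤ) i : ℝ)))
  refine tsum_congr fun v => ?_
  congr 1
  rw [Matrix.SpecialLinearGroup.coe_mul, ← Matrix.mulVec_mulVec]
  congr 1
  ext i
  have he : ((e v : {v : Fin 3 → ℤ // v ≠ 0}) : Fin 3 → ℤ) i =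
      ((A : Matrix (Fin 3) (Fin 3) ℤ) *ᵥ (v : Fin 3 → ℤ)) i := rfl
  rw [he]
  simp [Matrix.mulVec, dotProduct]

theorem latticeMeasure_lt_top (g : Matrix.SpecialLinearGroup (Fin 3) ℝ) {s : Set (Fin 3 → ℝ)}
    (hs : Bornology.IsBounded s) : latticeMeasure g s < ⊤ := by
  obtain ⟨R, hR⟩ := hs.subset_closedBall 0
  refine (measure_mono hR).trans_lt ?_
  rw [latticeMeasure_apply _ Metric.isClosed_closedBall.measurableSet]
  let A : Matrix (Fin 3) (Fin 3) ℝ := g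
  let T := LinearMap.toContinuousLinearMap (Matrix.toLin' (A⁻¹))
  have hT : ∀ w, w = T (A *ᵥ w) := fun w => by
    simp [T, Matrix.mulVec_mulVec, Matrix.nonsing_inv_mul _ (show IsUnit A.det by simp [A])]
  have hfin : {v : {v : Fin 3 → ℤ // v ≠ 0} |
      A *ᵥ (fun i => ((v : Fin 3 → ℤ) i : ℝ)) ∈ Metric.closedBall 0 R}.Finite := by
    have hball : (Metric.closedBall (0 : Fin 3 → ℤ) (‖T‖ * R)).Finite :=
      (isCompact_closedBall _ _).finite_of_discrete
    refine Set.Finite.of_finite_image (f := Subtype.val) (hball.subset ?_)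
      Subtype.val_injective.injOn
    rintro _ ⟨v, hv, rfl⟩
    rw [Set.mem_ofPred_eq, mem_closedBall_zero_iff] at hv
    have h1 : ‖(fun i => ((v : Fin 3 → ℤ) i : ℝ))‖ ≤ ‖T‖ * R := by
      rw [hT fun i => ((v : Fin 3 → ℤ) i : ℝ)]
      exact T.le_of_opNorm_le_of_le le_rfl hv
    rw [mem_closedBall_zero_iff]
    refine le_trans (le_of_eq ?_) h1
    simp only [Pi.norm_def, nnnorm, Int.norm_eq_abs, Real.norm_eq_abs]
  rw [tsum_eq_sum (s := hfin.toFinset)]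
  · refine ENNReal.sum_lt_top.mpr fun v _ => ?_
    exact lt_of_le_of_lt (Set.indicator_le_self _ (1 : (Fin 3 → ℝ) → ENNReal) _) ENNReal.one_lt_top
  · intro v hv
    rw [Set.Finite.mem_toFinset] at hv
    exact Set.indicator_of_notMem (s := Metric.closedBall 0 R) hv 1

theorem continuous_mulVec_apply (w : Fin 3 → ℝ) :
    Continuous fun g : Matrix.SpecialLinearGroup (Fin 3) ℝ =>
      (g : Matrix (Fin 3) (Fin 3) ℝ) *ᵥ w :=
  Continuous.matrix_mulVec continuous_induced_dom continuous_const

theorem lowerSemicontinuous_latticeMeasure {U : Set (Fin 3 → ℝ)} (hU : IsOpen U) :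
    LowerSemicontinuous fun g : Matrix.SpecialLinearGroup (Fin 3) ℝ => latticeMeasure g U := by
  simp_rw [fun g => latticeMeasure_apply g hU.measurableSet]
  refine lowerSemicontinuous_tsum fun v => ?_
  exact (hU.lowerSemicontinuous_indicator (zero_le_one (α := ENNReal))).comp
    (continuous_mulVec_apply _)

/-- The counting measure on the nonzero vectors of the lattice `x`. -/
noncomputable def pointMeasure (x : X) : Measure (Fin 3 → ℝ) := latticeMeasure x.out

theorem pointMeasure_mk (g : Matrix.SpecialLinearGroup (Fin 3) ℝ) :
    pointMeasure (QuotientGroup.mk g) = latticeMeasure g := by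
  obtain ⟨γ, hγ⟩ := QuotientGroup.mk_out_eq_mul SL3Z g
  rw [pointMeasure, hγ, latticeMeasure_mul_of_mem _ _ γ.2]

theorem pointMeasure_smul (g : Matrix.SpecialLinearGroup (Fin 3) ℝ) (x : X) :
    pointMeasure (g • x) =
      (pointMeasure x).map fun w => (g : Matrix (Fin 3) (Fin 3) ℝ) *ᵥ w := by
  induction x using QuotientGroup.induction_on with
  | H h => rw [pointMeasure_mk, ← latticeMeasure_mul, ← pointMeasure_mk]; rfl

theorem measurable_pointMeasure_isOpen {U : Set (Fin 3 → ℝ)} (hU : IsOpen U) :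
    Measurable fun x : X => pointMeasure x U := by
  refine LowerSemicontinuous.measurable (lowerSemicontinuous_iff_isOpen_preimage.mpr fun c => ?_)
  have h := (lowerSemicontinuous_latticeMeasure hU).isOpen_preimage c
  rw [← isQuotientMap_quotient_mk'.isOpen_preimage]
  convert h using 1
  ext g
  change c < pointMeasure (QuotientGroup.mk g) U ↔ c < latticeMeasure g U
  rw [pointMeasure_mk]

theorem measurable_pointMeasure : Measurable pointMeasure := by
  refine Measure.measurable_of_measurable_coe _ fun s hs => ?_
  have hball : ∀ n : ℕ, Measurable fun x : X =>
      (pointMeasure x).restrict (Metric.ball 0 (n : ℝ)) := by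
    intro n
    have : ∀ x : X, IsFiniteMeasure ((pointMeasure x).restrict (Metric.ball 0 (n : ℝ))) :=
      fun x => ⟨by
        rw [Measure.restrict_apply_univ]
        exact latticeMeasure_lt_top _ Metric.isBounded_ball⟩
    refine Measurable.measure_of_isPiSystem (S := {s | IsOpen s})
      (BorelSpace.measurable_eq (α := Fin 3 → ℝ)) isPiSystem_isOpen ?_ ?_
    · intro U (hU : IsOpen U)
      simp_rw [Measure.restrict_apply hU.measurableSet]
      exact measurable_pointMeasure_isOpen (hU.inter Metric.isOpen_ball)
    · simp_rw [Measure.restrict_apply_univ]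
      exact measurable_pointMeasure_isOpen Metric.isOpen_ball
  have hsup : ∀ x : X, pointMeasure x s =
      ⨆ n : ℕ, (pointMeasure x).restrict (Metric.ball 0 (n : ℝ)) s := by
    intro x
    simp_rw [Measure.restrict_apply hs]
    rw [← Monotone.measure_iUnion, ← Set.inter_iUnion, Metric.iUnion_ball_nat, Set.inter_univ]
    intro m n hmn
    exact Set.inter_subset_inter_right _ (Metric.ball_subset_ball (by exact_mod_cast hmn))
  simp_rw [hsup]
  exact Measurable.iSup fun n => (Measure.measurable_coe hs).comp (hball n)

theorem measurable_smul_quotient (g : Matrix.SpecialLinearGroup (Fin 3) ℝ) :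
    Measurable fun x : X => g • x := by
  refine Continuous.measurable ?_
  rw [isQuotientMap_quotient_mk'.continuous_iff]
  have hmul : Continuous fun h : Matrix.SpecialLinearGroup (Fin 3) ℝ => g * h :=
    continuous_induced_rng.mpr (continuous_const.matrix_mul continuous_induced_dom)
  exact continuous_quot_mk.comp hmul

theorem measurableSet_openBox (a b c d e f : ℝ) : MeasurableSet (openBox a b c d e f) :=
  ((measurableSet_Ioo.preimage (measurable_pi_apply 0)).inter
    ((measurableSet_Ioo.preimage (measurable_pi_apply 1)).inter
      (measurableSet_Ioo.preimage (measurable_pi_apply 2))))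

section Intensity

variable {mX : Measure X}

theorem measurePreserving_smul_quotient
    (hinv : ∀ g : Matrix.SpecialLinearGroup (Fin 3) ℝ,
      Measure.map (fun y : X => g • y) mX = mX) (g : Matrix.SpecialLinearGroup (Fin 3) ℝ) :
    MeasurePreserving (fun x : X => g • x) mX mX :=
  ⟨measurable_smul_quotient g, hinv g⟩

theorem bind_pointMeasure_openBox [IsProbabilityMeasure mX]
    (hinv : ∀ g : Matrix.SpecialLinearGroup (Fin 3) ℝ,
      Measure.map (fun y : X => g • y) mX = mX)
    {a b c d e f : ℝ} (ha : 0 < a) (hcd : c < d) (hef : e < f) :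
    mX.bind pointMeasure (openBox a b c d e f) =
      ENNReal.ofReal (b - a) * ENNReal.ofReal (d - c) * ENNReal.ofReal (f - e) := by
  have hbox := measurableSet_openBox a b c d e f
  have h0 : (0 : Fin 3 → ℝ) ∉ openBox a b c d e f := fun h => by
    have := h.1.1
    simp only [Pi.zero_apply] at this
    linarith
  rw [Measure.bind_apply hbox measurable_pointMeasure.aemeasurable]
  refine lintegral_eq_of_tendsto_average ((Measure.measurable_coe hbox).comp
    measurable_pointMeasure) (fun k => Finset.range ((k + 1) ^ 4) ×ˢ Finset.range ((k + 1) ^ 4))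
    (fun k => (((k + 1 : ℕ) : ENNReal) ^ 8)⁻¹) ?_ (fun k p x => shearDilation k p • x)
    (fun k p => measurePreserving_smul_quotient hinv _) ?_
  · intro k
    rw [Finset.card_product, Finset.card_range, ← pow_add, Nat.cast_pow]
    exact ENNReal.inv_mul_cancel (pow_ne_zero _ (by simp)) (ENNReal.pow_ne_top (by simp))
  · intro x
    induction x using QuotientGroup.induction_on with
    | H g =>
      refine (tendsto_average_openBox ha hcd hef g).congr fun k => ?_
      congr 1
      refine Finset.sum_congr rfl fun p _ => ?_
      change _ = pointMeasure (QuotientGroup.mk (shearDilation k p * g)) _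
      rw [pointMeasure_mk, latticeMeasure_apply_of_zero_notMem _ hbox h0]
      simp only [Matrix.SpecialLinearGroup.coe_mul, ← Matrix.mulVec_mulVec]

theorem map_mulVec_bind_pointMeasure
    (hinv : ∀ g : Matrix.SpecialLinearGroup (Fin 3) ℝ,
      Measure.map (fun y : X => g • y) mX = mX) (g : Matrix.SpecialLinearGroup (Fin 3) ℝ) :
    (mX.bind pointMeasure).map (fun w => (g : Matrix (Fin 3) (Fin 3) ℝ) *ᵥ w) =
      mX.bind pointMeasure := by
  have hg := (measurePreserving_mulVec g).measurable
  ext s hs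
  have hm : Measurable fun x : X => pointMeasure x s :=
    (Measure.measurable_coe hs).comp measurable_pointMeasure
  rw [Measure.map_apply hg hs, Measure.bind_apply (hg hs) measurable_pointMeasure.aemeasurable,
    Measure.bind_apply hs measurable_pointMeasure.aemeasurable,
    ← (measurePreserving_smul_quotient hinv g).lintegral_comp hm]
  refine lintegral_congr fun x => ?_
  rw [pointMeasure_smul, Measure.map_apply hg hs]

theorem restrict_bind_pointMeasure [IsProbabilityMeasure mX]
    (hinv : ∀ g : Matrix.SpecialLinearGroup (Fin 3) ℝ,
      Measure.map (fun y : X => g • y) mX = mX) {a : ℝ} (ha : 0 < a) :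
    (mX.bind pointMeasure).restrict {w | a < w 0} = volume.restrict {w | a < w 0} := by
  let s : Fin 3 → Set ℝ := ![Set.Ioi a, Set.univ, Set.univ]
  have hs : {w : Fin 3 → ℝ | a < w 0} = Set.univ.pi s := by
    ext w
    simp [s, Fin.forall_fin_succ]
  rw [hs, volume_pi, Measure.restrict_pi_pi]
  symm
  refine Measure.pi_eq_generateFrom
    (fun _ => Real.borel_eq_generateFrom_Ioo_rat.symm.trans BorelSpace.measurable_eq.symm)
    (fun _ => Real.isPiSystem_Ioo_rat) (fun i => Real.finiteSpanningSetsInIooRat _) ?_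
  intro t ht
  have hex : ∀ i, ∃ p q : ℚ, p < q ∧ t i = Set.Ioo (p : ℝ) q := by
    intro i
    simpa using ht i
  choose p q hpq ht using hex
  have htm : MeasurableSet (Set.univ.pi t) := by
    refine MeasurableSet.univ_pi fun i => ?_
    rw [ht i]
    exact measurableSet_Ioo
  have hbox : Set.univ.pi t ∩ Set.univ.pi s =
      openBox (max (p 0) a) (q 0) (p 1) (q 1) (p 2) (q 2) := by
    ext w
    simp only [s, openBox, ht, Set.mem_inter_iff, Set.mem_pi, Set.mem_univ, true_imp_iff,
      Fin.forall_fin_succ, Set.mem_ofPred_eq, Set.mem_Ioo, max_lt_iff]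
    simp
    tauto
  rw [Measure.restrict_apply htm, hbox, bind_pointMeasure_openBox hinv (lt_max_of_lt_right ha)
    (by exact_mod_cast hpq 1) (by exact_mod_cast hpq 2), Fin.prod_univ_three]
  simp only [ht, Measure.restrict_apply measurableSet_Ioo]
  simp [Set.Ioo_inter_Ioi]

theorem restrict_preimage_bind_pointMeasure [IsProbabilityMeasure mX]
    (hinv : ∀ g : Matrix.SpecialLinearGroup (Fin 3) ℝ,
      Measure.map (fun y : X => g • y) mX = mX) {a : ℝ} (ha : 0 < a)
    (g : Matrix.SpecialLinearGroup (Fin 3) ℝ) :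
    (mX.bind pointMeasure).restrict {w | a < ((g : Matrix (Fin 3) (Fin 3) ℝ) *ᵥ w) 0} =
      volume.restrict {w | a < ((g : Matrix (Fin 3) (Fin 3) ℝ) *ᵥ w) 0} := by
  ext s hs
  have hg := (measurePreserving_mulVec g).measurable
  have hg' := (measurePreserving_mulVec g⁻¹).measurable
  have hE : MeasurableSet {w : Fin 3 → ℝ | a < w 0} :=
    measurableSet_lt measurable_const (measurable_pi_apply 0)
  have hpre : s ∩ {w | a < ((g : Matrix (Fin 3) (Fin 3) ℝ) *ᵥ w) 0} =
      (fun w => (g : Matrix (Fin 3) (Fin 3) ℝ) *ᵥ w) ⁻¹'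
        ((fun w => ((g⁻¹ : Matrix.SpecialLinearGroup (Fin 3) ℝ) : Matrix (Fin 3) (Fin 3) ℝ) *ᵥ w)
          ⁻¹' s ∩ {w | a < w 0}) := by
    ext w
    simp only [Set.mem_inter_iff, Set.mem_preimage, Set.mem_ofPred_eq]
    rw [Matrix.mulVec_mulVec, ← Matrix.SpecialLinearGroup.coe_mul, inv_mul_cancel,
      Matrix.SpecialLinearGroup.coe_one, Matrix.one_mulVec]
  rw [Measure.restrict_apply hs, Measure.restrict_apply hs, hpre,
    (measurePreserving_mulVec g).measure_preimage ((hg' hs).inter hE).nullMeasurableSet,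
    ← Measure.map_apply hg ((hg' hs).inter hE), map_mulVec_bind_pointMeasure hinv g,
    ← Measure.restrict_apply (hg' hs), ← Measure.restrict_apply (hg' hs),
    restrict_bind_pointMeasure hinv ha]

theorem exists_specialLinearGroup_mulVec_zero_eq (i : Fin 3) {ε : ℝ} (hε : ε * ε = 1) :
    ∃ g : Matrix.SpecialLinearGroup (Fin 3) ℝ,
      ∀ w, ((g : Matrix (Fin 3) (Fin 3) ℝ) *ᵥ w) 0 = ε * w i := by
  fin_cases i
  · refine ⟨⟨!![ε, 0, 0; 0, ε, 0; 0, 0, 1], by simp [Matrix.det_fin_three, hε]⟩, fun w => ?_⟩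
    simp [Matrix.mulVec, dotProduct, Fin.sum_univ_three]
  · refine ⟨⟨!![0, ε, 0; 0, 0, ε; 1, 0, 0], by simp [Matrix.det_fin_three, hε]⟩, fun w => ?_⟩
    simp [Matrix.mulVec, dotProduct, Fin.sum_univ_three]
  · refine ⟨⟨!![0, 0, ε; ε, 0, 0; 0, 1, 0], by simp [Matrix.det_fin_three, hε]⟩, fun w => ?_⟩
    simp [Matrix.mulVec, dotProduct, Fin.sum_univ_three]

theorem bind_pointMeasure_eq_volume [IsProbabilityMeasure mX]
    (hinv : ∀ g : Matrix.SpecialLinearGroup (Fin 3) ℝ,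
      Measure.map (fun y : X => g • y) mX = mX) :
    mX.bind pointMeasure = volume := by
  have hzero : mX.bind pointMeasure {0} = 0 := by
    rw [Measure.bind_apply (measurableSet_singleton 0) measurable_pointMeasure.aemeasurable]
    have : ∀ x : X, pointMeasure x {0} = 0 := by
      intro x
      rw [pointMeasure, latticeMeasure_apply _ (measurableSet_singleton 0), ENNReal.tsum_eq_zero]
      intro v
      refine Set.indicator_of_notMem (fun h => v.2 ?_) _
      have hv := congrArg (fun w => ((x.out⁻¹ : Matrix.SpecialLinearGroup (Fin 3) ℝ) :
        Matrix (Fin 3) (Fin 3) ℝ) *ᵥ w) (Set.mem_singleton_iff.mp h)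
      simp only [Matrix.mulVec_mulVec, ← Matrix.SpecialLinearGroup.coe_mul, inv_mul_cancel,
        Matrix.SpecialLinearGroup.coe_one, Matrix.one_mulVec, Matrix.mulVec_zero] at hv
      ext i
      have hi : (((v : Fin 3 → ℤ) i : ℤ) : ℝ) = 0 := congrFun hv i
      exact Int.cast_eq_zero.mp hi
    simp [this]
  have hε : ∀ σ : ℤˣ, ((σ : ℤ) : ℝ) * ((σ : ℤ) : ℝ) = 1 := fun σ => by
    exact_mod_cast Int.units_coe_mul_self σ
  choose g hg using fun q : Fin 3 × ℤˣ =>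
    exists_specialLinearGroup_mulVec_zero_eq q.1 (hε q.2)
  let s : Option ((Fin 3 × ℤˣ) × ℕ) → Set (Fin 3 → ℝ) := fun o => o.elim {0} fun q =>
    {w | 1 / ((q.2 : ℝ) + 1) < ((g q.1 : Matrix (Fin 3) (Fin 3) ℝ) *ᵥ w) 0}
  have hs : ⋃ o, s o = Set.univ := by
    refine Set.eq_univ_of_forall fun w => Set.mem_iUnion.mpr ?_
    by_cases hw : w = 0
    · exact ⟨none, hw⟩
    · obtain ⟨i, hi⟩ := Function.ne_iff.mp hw
      have hσ : ∃ σ : ℤˣ, 0 < ((σ : ℤ) : ℝ) * w i := by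
        rcases lt_or_gt_of_ne hi with h | h
        · exact ⟨-1, by simpa using h⟩
        · exact ⟨1, by simpa using h⟩
      obtain ⟨σ, hσ⟩ := hσ
      obtain ⟨n, hn⟩ := exists_nat_one_div_lt hσ
      refine ⟨some ((i, σ), n), ?_⟩
      change 1 / ((n : ℝ) + 1) < ((g (i, σ) : Matrix (Fin 3) (Fin 3) ℝ) *ᵥ w) 0
      rw [hg]
      exact hn
  rw [Measure.ext_iff_of_iUnion_eq_univ hs]
  rintro (_ | q)
  · change (mX.bind pointMeasure).restrict {0} = volume.restrict {0}
    rw [Measure.restrict_eq_zero.mpr hzero, Measure.restrict_eq_zero.mpr (by simp)]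
  · exact restrict_preimage_bind_pointMeasure hinv (by positivity) (g q.1)

end Intensity

theorem integrable_of_isBounded_support {ν : Measure (Fin 3 → ℝ)}
    (hν : ∀ s, Bornology.IsBounded s → ν s < ⊤) {φ : (Fin 3 → ℝ) → ℝ} (hφmeas : Measurable φ)
    (hφbdd : ∃ M : ℝ, ∀ v, |φ v| ≤ M) (hφsupp : Bornology.IsBounded {v | φ v ≠ 0}) :
    Integrable φ ν := by
  obtain ⟨M, hM⟩ := hφbdd
  rw [← integrableOn_iff_integrable_of_support_subset (s := {v | φ v ≠ 0}) fun v hv => hv]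
  exact Measure.integrableOn_of_bounded (hν _ hφsupp).ne hφmeas.aestronglyMeasurable
    (ae_of_all _ hM)

/-- Siegel integral formula. -/
theorem stmt18 (mX : Measure X) [IsProbabilityMeasure mX]
    (hinv : ∀ g : Matrix.SpecialLinearGroup (Fin 3) ℝ,
      Measure.map (fun y : X => g • y) mX = mX)
    (φ : (Fin 3 → ℝ) → ℝ) (hφmeas : Measurable φ)
    (hφbdd : ∃ M : ℝ, ∀ v, |φ v| ≤ M)
    (hφsupp : Bornology.IsBounded {v | φ v ≠ 0})
    (F : X → ℝ)
    (hF : ∀ g : Matrix.SpecialLinearGroup (Fin 3) ℝ,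
      F (QuotientGroup.mk g) =
        ∑' v : {v : Fin 3 → ℤ // v ≠ 0},
          φ ((g : Matrix (Fin 3) (Fin 3) ℝ).mulVec (fun i => ((v : Fin 3 → ℤ) i : ℝ)))) :
    Integrable F mX ∧ ∫ y, F y ∂mX = ∫ v, φ v := by
  have hint : Integrable φ (volume : Measure (Fin 3 → ℝ)) :=
    integrable_of_isBounded_support (fun _ hs => hs.measure_lt_top) hφmeas hφbdd hφsupp
  let κ : ProbabilityTheory.Kernel X (Fin 3 → ℝ) := ⟨pointMeasure, measurable_pointMeasure⟩
  have hκ : mX.bind κ = volume := bind_pointMeasure_eq_volume hinv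
  have hF' : F = fun x => ∫ w, φ w ∂κ x := by
    funext x
    induction x using QuotientGroup.induction_on with
    | H g =>
      change _ = ∫ w, φ w ∂pointMeasure (QuotientGroup.mk g)
      have hg : Integrable φ (latticeMeasure g) :=
        integrable_of_isBounded_support (fun _ hs => latticeMeasure_lt_top g hs)
          hφmeas hφbdd hφsupp
      rw [hF, pointMeasure_mk, latticeMeasure, integral_sum_measure hg]
      simp only [integral_dirac]
  rw [← hκ, Measure.comp_eq_comp_const_apply] at hint
  rw [← hκ, Measure.comp_eq_comp_const_apply, ProbabilityTheory.Kernel.integral_comp hint, hF',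
    ProbabilityTheory.Kernel.const_apply]
  refine ⟨?_, rfl⟩
  have := hint.integral_comp
  rwa [ProbabilityTheory.Kernel.const_apply] at this
end
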